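/- arXiv:2603.23305 — 2 statements merged into one kernel-verified Lean document; each statement's English description precedes it below -/
import Mathlib

section
/- (MAP success on all orbits.) In the Gaussian contextual graph matching model with π* = id, assume d = ω(log n) and that for some ε > 0 and all sufficiently large n, ρ²n/(1−ρ²) + η²d/(1−η²) ≥ 4(1+ε) log n. For t ∈ {2,…,n} let E_t := {∃ π ∈ S_{n,t} : V(π) < 0}. Then P( ⋃_{2≤t≤n} E_t ) = o(1) as n → ∞. -/
open MeasureTheory ProbabilityTheory Real Filter Finset Topology

noncomputable section

namespace CGM

/-- array of (potential) edge weights of a graph on `n` vertices -/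
abbrev GW (n : ℕ) := Fin n → Fin n → ℝ

/-- array of feature values: `n` users, `d` features each -/
abbrev FW (n d : ℕ) := Fin n → Fin d → ℝ

/-- latent sample space: (graph weights, graph noise, features, feature noise) -/
abbrev Samp (n d : ℕ) := (GW n × GW n) × (FW n d × FW n d)

/-- i.i.d. standard Gaussian array (graph part) -/
def stdGaussG (n : ℕ) : Measure (GW n) :=
  Measure.pi fun _ => Measure.pi fun _ => gaussianReal 0 1

/-- i.i.d. standard Gaussian array (feature part) -/
def stdGaussF (n d : ℕ) : Measure (FW n d) :=
  Measure.pi fun _ => Measure.pi fun _ => gaussianReal 0 1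

/-- law of the latent randomness of the model -/
def μ (n d : ℕ) : Measure (Samp n d) :=
  ((stdGaussG n).prod (stdGaussG n)).prod ((stdGaussF n d).prod (stdGaussF n d))

/-- symmetrization of an array, so that only the upper-triangular part matters -/
def sym {n : ℕ} (f : GW n) : GW n := fun i j => if i ≤ j then f i j else f j i

variable {n d : ℕ}

/-- the weighted adjacency matrix `A` -/
def Amat (ω : Samp n d) : GW n := sym ω.1.1

/-- the weighted adjacency matrix `B` (before relabeling by `π*`, i.e. conditionally
on `π* = id`): each pair `(A i j, B i j)`, `i < j`, is bivariate centered Gaussian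
with unit variances and correlation `ρ`. -/
def Bmat (ρ : ℝ) (ω : Samp n d) : GW n :=
  fun i j => ρ * Amat ω i j + Real.sqrt (1 - ρ ^ 2) * sym ω.1.2 i j

/-- the feature matrix `X` -/
def Xmat (ω : Samp n d) : FW n d := ω.2.1

/-- the feature matrix `Y` (conditionally on `π* = id`): each pair `(X i j, Y i j)` is
bivariate centered Gaussian with unit variances and correlation `η`. -/
def Ymat (η : ℝ) (ω : Samp n d) : FW n d :=
  fun i j => η * ω.2.1 i j + Real.sqrt (1 - η ^ 2) * ω.2.2 i j

/-- the ordered pairs `i < j` whose unordered pair `{i,j}` is moved by `φ`;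
its cardinality is `|D^E_φ|`. -/
def movedEdges (φ : Equiv.Perm (Fin n)) : Finset (Fin n × Fin n) :=
  Finset.univ.filter fun p =>
    p.1 < p.2 ∧ ¬((φ p.1 = p.1 ∧ φ p.2 = p.2) ∨ (φ p.1 = p.2 ∧ φ p.2 = p.1))

/-- `V*_G(φ) = Σ_{{i,j} ∈ D^E_φ} B_{ij} A_{ij}` -/
def VGstar (ρ : ℝ) (φ : Equiv.Perm (Fin n)) (ω : Samp n d) : ℝ :=
  ∑ p ∈ movedEdges φ, Bmat ρ ω p.1 p.2 * Amat ω p.1 p.2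

/-- `V_G(φ) = Σ_{{i,j} ∈ D^E_φ} B_{φ(i,j)} A_{ij}` -/
def VG (ρ : ℝ) (φ : Equiv.Perm (Fin n)) (ω : Samp n d) : ℝ :=
  ∑ p ∈ movedEdges φ, Bmat ρ ω (φ p.1) (φ p.2) * Amat ω p.1 p.2

/-- `V*_F(φ) = Σ_{i ∈ D_φ, j ≤ d} Y_{ij} X_{ij}` -/
def VFstar (η : ℝ) (φ : Equiv.Perm (Fin n)) (ω : Samp n d) : ℝ :=
  ∑ i ∈ φ.support, ∑ j, Ymat η ω i j * Xmat ω i j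

/-- `V_F(φ) = Σ_{i ∈ D_φ, j ≤ d} Y_{φ(i),j} X_{ij}` -/
def VF (η : ℝ) (φ : Equiv.Perm (Fin n)) (ω : Samp n d) : ℝ :=
  ∑ i ∈ φ.support, ∑ j, Ymat η ω (φ i) j * Xmat ω i j

/-- the Hamiltonian `V(φ)` -/
def V (ρ η : ℝ) (φ : Equiv.Perm (Fin n)) (ω : Samp n d) : ℝ :=
  ρ / (1 - ρ ^ 2) * (VGstar ρ φ ω - VG ρ φ ω)
    + η / (1 - η ^ 2) * (VFstar η φ ω - VF η φ ω)

/-- the partition function `Z = Σ_φ exp(−V(φ))` -/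
def Zpart (ρ η : ℝ) (ω : Samp n d) : ℝ :=
  ∑ φ : Equiv.Perm (Fin n), Real.exp (-(V ρ η φ ω))

end CGM

namespace CGM

/-- The exponential of a real number, as an extended nonnegative real. -/
def eexp (x : ℝ) : ENNReal := ENNReal.ofReal (Real.exp x)

lemma eexp_add (x y : ℝ) : eexp (x + y) = eexp x * eexp y := by
  rw [eexp, Real.exp_add, ENNReal.ofReal_mul (Real.exp_nonneg _)]; rfl

lemma eexp_zero : eexp 0 = 1 := by simp [eexp]

lemma eexp_sum {ι : Type*} (s : Finset ι) (f : ι → ℝ) :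
    eexp (∑ i ∈ s, f i) = ∏ i ∈ s, eexp (f i) := by
  rw [eexp, Real.exp_sum, ENNReal.ofReal_prod_of_nonneg fun _ _ => Real.exp_nonneg _]; rfl

lemma eexp_mono {x y : ℝ} (h : x ≤ y) : eexp x ≤ eexp y :=
  ENNReal.ofReal_le_ofReal (Real.exp_le_exp.2 h)

lemma measurable_eexp : Measurable eexp :=
  ENNReal.measurable_ofReal.comp Real.measurable_exp

@[fun_prop]
lemma _root_.Measurable.eexp {α : Type*} [MeasurableSpace α] {f : α → ℝ} (hf : Measurable f) :
    Measurable fun a => CGM.eexp (f a) := measurable_eexp.comp hf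

lemma lintegral_eexp_mul_gaussian (v : ℝ) :
    ∫⁻ z, eexp (v * z) ∂(gaussianReal 0 1) = eexp (v ^ 2 / 2) := by
  have h := mgf_gaussianReal (p := gaussianReal 0 1) (X := id) (μ := 0) (v := 1) (by simp) v
  simp only [mgf, id] at h
  unfold eexp
  rw [← ofReal_integral_eq_lintegral_ofReal (integrable_exp_mul_gaussianReal v)
    (ae_of_all _ fun _ => Real.exp_nonneg _), h]
  congr 2
  simp

lemma neg_half_log_le {c : ℝ} (hc : |c| ≤ 1 / 4) :
    -(Real.log (1 - 2 * c) / 2) ≤ c + 4 * c ^ 2 := by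
  obtain ⟨h1, h2⟩ := abs_le.1 hc
  have hp : 0 < 1 - 2 * c := by linarith
  have h3 := Real.one_sub_inv_le_log_of_pos hp
  have h4 : (1 - 2 * c)⁻¹ ≤ 1 + 2 * c + 8 * c ^ 2 := by
    rw [inv_le_iff_one_le_mul₀ hp]
    nlinarith [mul_nonneg (sq_nonneg c) (by linarith : 0 ≤ 1 - 4 * c)]
  linarith

lemma lintegral_eexp_sq_gaussian_le {c : ℝ} (hc : |c| ≤ 1 / 4) :
    ∫⁻ z, eexp (c * z ^ 2) ∂(gaussianReal 0 1) ≤ eexp (c + 4 * c ^ 2) := by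
  obtain ⟨h1, h2⟩ := abs_le.1 hc
  have hp : 0 < 1 / 2 - c := by linarith
  have hq : 0 < 1 - 2 * c := by linarith
  rw [gaussianReal_of_var_ne_zero _ one_ne_zero,
    lintegral_withDensity_eq_lintegral_mul _ (measurable_gaussianPDF 0 1) (by fun_prop)]
  have e : ∀ z : ℝ, (gaussianPDF 0 1 * fun z => eexp (c * z ^ 2)) z
      = ENNReal.ofReal ((√(2 * π))⁻¹ * Real.exp (-(1 / 2 - c) * z ^ 2)) := by
    intro z
    simp only [Pi.mul_apply, gaussianPDF, gaussianPDFReal, eexp]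
    rw [← ENNReal.ofReal_mul (by positivity), mul_assoc, ← Real.exp_add]
    congr 2
    · simp
    · congr 1; push_cast; ring
  simp_rw [e]
  rw [← ofReal_integral_eq_lintegral_ofReal ((integrable_exp_neg_mul_sq hp).const_mul _)
    (ae_of_all _ fun _ => by positivity), integral_const_mul, integral_gaussian]
  refine ENNReal.ofReal_le_ofReal ?_
  have : (√(2 * π))⁻¹ * √(π / (1 / 2 - c)) = Real.exp (-(Real.log (1 - 2 * c) / 2)) := by
    rw [Real.exp_neg, Real.exp_half, Real.exp_log hq, ← Real.sqrt_inv, ← Real.sqrt_inv,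
      ← Real.sqrt_mul (by positivity)]
    congr 1
    have := Real.pi_ne_zero
    have h5 : (1 / 2 - c) ≠ 0 := hp.ne'
    have h6 : (1 - 2 * c) ≠ 0 := hq.ne'
    field_simp
  rw [this]
  exact Real.exp_le_exp.2 (neg_half_log_le hc)

section Product

variable {ι : Type*} [Fintype ι]

/-- The law of an i.i.d. standard Gaussian family indexed by `ι`. -/
def stdPi (ι : Type*) [Fintype ι] : Measure (ι → ℝ) := Measure.pi fun _ => gaussianReal 0 1

instance : IsProbabilityMeasure (stdPi ι) := by unfold stdPi; infer_instance

lemma lintegral_eexp_sum_stdPi (f : ι → ℝ → ℝ) (hf : ∀ i, Measurable (f i)) :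
    ∫⁻ a, eexp (∑ i, f i (a i)) ∂(stdPi ι)
      = ∏ i, ∫⁻ z, eexp (f i z) ∂(gaussianReal 0 1) := by
  simp_rw [eexp_sum]
  have hind : iIndepFun (fun i (a : ι → ℝ) => eexp (f i (a i))) (stdPi ι) :=
    iIndepFun_pi (X := fun i z => eexp (f i z)) fun i => (hf i).eexp.aemeasurable
  rw [lintegral_prod_eq_prod_lintegral_of_indepFun _ _ hind (fun i => by fun_prop)]
  refine Finset.prod_congr rfl fun i _ => ?_
  exact (measurePreserving_eval (fun _ : ι => gaussianReal 0 1) i).lintegral_comp (hf i).eexp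

lemma lintegral_eexp_linear_stdPi (v : ι → ℝ) :
    ∫⁻ z, eexp (∑ i, v i * z i) ∂(stdPi ι) = eexp (∑ i, v i ^ 2 / 2) := by
  rw [lintegral_eexp_sum_stdPi (fun i z => v i * z) (fun i => by fun_prop), eexp_sum]
  simp_rw [lintegral_eexp_mul_gaussian]

lemma lintegral_eexp_sq_stdPi_le (c : ι → ℝ) (hc : ∀ i, |c i| ≤ 1 / 4) :
    ∫⁻ z, eexp (∑ i, c i * z i ^ 2) ∂(stdPi ι) ≤ eexp (∑ i, (c i + 4 * c i ^ 2)) := by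
  rw [lintegral_eexp_sum_stdPi (fun i z => c i * z ^ 2) (fun i => by fun_prop), eexp_sum]
  exact Finset.prod_le_prod' fun i _ => lintegral_eexp_sq_gaussian_le (hc i)

lemma measurePreserving_piecewise_stdPi [DecidableEq ι] (S : Finset ι) :
    MeasurePreserving (fun q : (ι → ℝ) × (ι → ℝ) => S.piecewise q.1 q.2)
      ((stdPi ι).prod (stdPi ι)) (stdPi ι) := by
  have hm : Measurable (fun q : (ι → ℝ) × (ι → ℝ) => S.piecewise q.1 q.2) := by
    refine measurable_pi_iff.2 fun i => ?_
    by_cases hi : i ∈ S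
    · simp only [Finset.piecewise, hi, if_true]; fun_prop
    · simp only [Finset.piecewise, hi, if_false]; fun_prop
  refine ⟨hm, ?_⟩
  rw [stdPi]
  refine (Measure.pi_eq fun s hs => ?_).symm
  rw [Measure.map_apply hm (MeasurableSet.univ_pi hs)]
  have hpre : (fun q : (ι → ℝ) × (ι → ℝ) => S.piecewise q.1 q.2) ⁻¹' (Set.univ.pi s)
      = (Set.univ.pi fun i => if i ∈ S then s i else Set.univ) ×ˢ
        (Set.univ.pi fun i => if i ∈ S then Set.univ else s i) := by
    ext q
    simp only [Set.mem_preimage, Set.mem_pi, Set.mem_univ, true_imp_iff, Set.mem_prod,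
      ← forall_and]
    refine forall_congr' fun i => ?_
    by_cases hi : i ∈ S <;> simp [Finset.piecewise, hi]
  rw [hpre, Measure.prod_prod, Measure.pi_pi, Measure.pi_pi, ← Finset.prod_mul_distrib]
  refine Finset.prod_congr rfl fun i _ => ?_
  by_cases hi : i ∈ S <;> simp [hi]

end Product

section Quadratic

variable {ι : Type*} [Fintype ι] [DecidableEq ι]

lemma four_mul_card_separating {e e' : ι} (h : e ≠ e') :
    4 * #{S : Finset ι | e ∈ S ∧ e' ∉ S} = 2 ^ Fintype.card ι := by
  have hcard : #{S : Finset ι | e ∈ S ∧ e' ∉ S} = #(univ \ {e, e'} : Finset ι).powerset := by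
    refine Finset.card_nbij' (fun S => S.erase e) (fun S => insert e S) ?_ ?_ ?_ ?_
    · intro S hS
      simp only [Finset.coe_filter, Finset.mem_univ, true_and, Set.mem_ofPred_eq] at hS
      simp only [Finset.coe_powerset, Set.mem_preimage, Set.mem_powerset_iff, Finset.coe_subset]
      intro i hi
      have := Finset.mem_erase.1 hi
      simp only [Finset.mem_sdiff, Finset.mem_univ, true_and, Finset.mem_insert,
        Finset.mem_singleton, not_or]
      exact ⟨this.1, fun h' => hS.2 (h' ▸ this.2)⟩
    · intro S hS
      simp only [Finset.coe_powerset, Set.mem_preimage, Set.mem_powerset_iff,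
        Finset.coe_subset] at hS
      simp only [Finset.coe_filter, Finset.mem_univ, true_and, Set.mem_ofPred_eq]
      refine ⟨Finset.mem_insert_self _ _, fun h' => ?_⟩
      rcases Finset.mem_insert.1 h' with h' | h'
      · exact h h'.symm
      · simpa using hS h'
    · intro S hS
      simp only [Finset.coe_filter, Finset.mem_univ, true_and, Set.mem_ofPred_eq] at hS
      exact Finset.insert_erase hS.1
    · intro S hS
      simp only [Finset.coe_powerset, Set.mem_preimage, Set.mem_powerset_iff,
        Finset.coe_subset] at hS
      exact Finset.erase_insert fun h' => by simpa using hS h'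
  have h2 : #({e, e'} : Finset ι) = 2 := Finset.card_pair h
  have hle : 2 ≤ Fintype.card ι := h2 ▸ Finset.card_le_univ _
  rw [hcard, Finset.card_powerset, Finset.card_univ_sdiff, h2]
  obtain ⟨k, hk⟩ := Nat.exists_eq_add_of_le hle
  rw [hk, Nat.add_sub_cancel_left, pow_add]
  norm_num

lemma sum_support_eq_sum_separating (σ : Equiv.Perm ι) (f : ι → ℝ) :
    ∑ e ∈ σ.support, f e
      = ∑ S : Finset ι, ((2 : ℝ) ^ Fintype.card ι)⁻¹ *
          (4 * ∑ e, if e ∈ S ∧ σ e ∉ S then f e else 0) := by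
  rw [← Finset.mul_sum, ← Finset.mul_sum, Finset.sum_comm]
  have h : ∀ e, (∑ S : Finset ι, if e ∈ S ∧ σ e ∉ S then f e else 0)
      = if e ∈ σ.support then (2 : ℝ) ^ Fintype.card ι / 4 * f e else 0 := by
    intro e
    rw [← Finset.sum_filter, Finset.sum_const, nsmul_eq_mul]
    split_ifs with he
    · have := four_mul_card_separating (Equiv.Perm.mem_support.1 he).symm
      have h' : (4 : ℝ) * (#{S : Finset ι | e ∈ S ∧ σ e ∉ S} : ℝ) = 2 ^ Fintype.card ι := by
        exact_mod_cast this
      rw [← h']; ring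
    · rw [Equiv.Perm.notMem_support.1 he]
      simp
  simp_rw [h]
  rw [← Finset.sum_filter, Finset.filter_mem_eq_inter, Finset.univ_inter, ← Finset.mul_sum]
  field_simp

lemma sum_perm_comp (σ : Equiv.Perm ι) {T : Finset ι} (hT : σ.support ⊆ T) (f : ι → ℝ) :
    ∑ e ∈ T, f (σ e) = ∑ e ∈ T, f e :=
  Equiv.Perm.sum_comp σ T f fun _ he => hT (Equiv.Perm.mem_support.2 he)

lemma lintegral_eexp_separated_le (σ : Equiv.Perm ι) (S : Finset ι) {u : ℝ}
    (hu : 32 * u ^ 2 ≤ 1) :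
    ∫⁻ a, eexp (u * (4 * ∑ e, if e ∈ S ∧ σ e ∉ S then a e * a (σ e) else 0)) ∂(stdPi ι)
      ≤ eexp (16 * u ^ 2 * #σ.support) := by
  rw [← (measurePreserving_piecewise_stdPi S).lintegral_comp (by
    refine Measurable.eexp ?_
    refine measurable_const.mul (measurable_const.mul (Finset.measurable_sum _ fun e _ => ?_))
    split_ifs <;> fun_prop)]
  have e1 : ∀ q : (ι → ℝ) × (ι → ℝ),
      u * (4 * ∑ e, if e ∈ S ∧ σ e ∉ S then S.piecewise q.1 q.2 e * S.piecewise q.1 q.2 (σ e)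
        else 0)
      = ∑ e, (if e ∈ S ∧ σ e ∉ S then 4 * u * q.2 (σ e) else 0) * q.1 e := by
    intro q
    rw [Finset.mul_sum, Finset.mul_sum]
    refine Finset.sum_congr rfl fun e _ => ?_
    split_ifs with h
    · simp only [Finset.piecewise, h.1, h.2, if_true, if_false]; ring
    · simp
  simp_rw [e1]
  rw [lintegral_prod_symm _ (by
    refine (Measurable.eexp ?_).aemeasurable
    refine Finset.measurable_sum _ fun e _ => Measurable.mul ?_ (by fun_prop)
    split_ifs <;> fun_prop)]
  simp_rw [lintegral_eexp_linear_stdPi]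
  have hc : ∀ e, |if e ∈ σ.support then 8 * u ^ 2 else 0| ≤ 1 / 4 := by
    intro e
    split_ifs
    · rw [abs_of_nonneg (by positivity)]; linarith
    · norm_num
  refine le_trans (lintegral_mono fun z => eexp_mono ?_)
    (le_trans (lintegral_eexp_sq_stdPi_le _ hc) (eexp_mono ?_))
  · have h1 : ∑ e, (if e ∈ σ.support then 8 * u ^ 2 else 0) * z e ^ 2
        = ∑ e ∈ σ.support, 8 * u ^ 2 * z (σ e) ^ 2 := by
      rw [sum_perm_comp σ subset_rfl (fun e => 8 * u ^ 2 * z e ^ 2)]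
      simp_rw [ite_mul, zero_mul]
      rw [← Finset.sum_filter, Finset.filter_mem_eq_inter, Finset.univ_inter]
    rw [h1, ← Finset.sum_subset (Finset.subset_univ σ.support)]
    · refine Finset.sum_le_sum fun e _ => ?_
      split_ifs
      · exact le_of_eq (by ring)
      · have : 0 ≤ 8 * u ^ 2 * z (σ e) ^ 2 := by positivity
        simpa using this
    · intro e _ he
      rw [Equiv.Perm.notMem_support.1 he]
      simp
  · have h2 : ∀ e, ((if e ∈ σ.support then 8 * u ^ 2 else 0)
        + 4 * (if e ∈ σ.support then 8 * u ^ 2 else 0) ^ 2 : ℝ)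
        ≤ if e ∈ σ.support then 16 * u ^ 2 else 0 := by
      intro e
      split_ifs
      · nlinarith [sq_nonneg u]
      · norm_num
    refine (Finset.sum_le_sum fun e _ => h2 e).trans (le_of_eq ?_)
    rw [← Finset.sum_filter, Finset.filter_mem_eq_inter, Finset.univ_inter, Finset.sum_const,
      nsmul_eq_mul, mul_comm]

lemma lintegral_eexp_perm_le (σ : Equiv.Perm ι) {u : ℝ} (hu : 32 * u ^ 2 ≤ 1) :
    ∫⁻ a, eexp (u * ∑ e ∈ σ.support, a e * a (σ e)) ∂(stdPi ι)
      ≤ eexp (16 * u ^ 2 * #σ.support) := by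
  set w : ℝ := ((2 : ℝ) ^ Fintype.card ι)⁻¹ with hw
  have hw0 : 0 ≤ w := by positivity
  have hw1 : ∑ _S : Finset ι, w = 1 := by
    rw [Finset.sum_const, Finset.card_univ, Fintype.card_finset, nsmul_eq_mul, hw]
    push_cast
    exact mul_inv_cancel₀ (by positivity)
  have hjensen : ∀ a : ι → ℝ, eexp (u * ∑ e ∈ σ.support, a e * a (σ e)) ≤
      ∑ S : Finset ι, ENNReal.ofReal w *
        eexp (u * (4 * ∑ e, if e ∈ S ∧ σ e ∉ S then a e * a (σ e) else 0)) := by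
    intro a
    have h := convexOn_exp.map_sum_le (t := Finset.univ) (w := fun _ : Finset ι => w)
      (p := fun S => u * (4 * ∑ e, if e ∈ S ∧ σ e ∉ S then a e * a (σ e) else 0))
      (fun _ _ => hw0) hw1 (fun _ _ => Set.mem_univ _)
    have hs : u * ∑ e ∈ σ.support, a e * a (σ e) = ∑ S : Finset ι,
        w • (u * (4 * ∑ e, if e ∈ S ∧ σ e ∉ S then a e * a (σ e) else 0)) := by
      rw [sum_support_eq_sum_separating, Finset.mul_sum]
      exact Finset.sum_congr rfl fun S _ => by rw [smul_eq_mul]; ring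
    rw [← hs] at h
    refine (ENNReal.ofReal_le_ofReal h).trans (le_of_eq ?_)
    rw [ENNReal.ofReal_sum_of_nonneg fun _ _ => smul_nonneg hw0 (Real.exp_nonneg _)]
    exact Finset.sum_congr rfl fun S _ => ENNReal.ofReal_mul hw0
  have hmeas : ∀ S : Finset ι, Measurable fun a : ι → ℝ =>
      eexp (u * (4 * ∑ e, if e ∈ S ∧ σ e ∉ S then a e * a (σ e) else 0)) := by
    intro S
    refine Measurable.eexp ?_
    refine measurable_const.mul (measurable_const.mul (Finset.measurable_sum _ fun e _ => ?_))
    split_ifs <;> fun_prop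
  refine (lintegral_mono hjensen).trans ?_
  rw [lintegral_finsetSum _ fun S _ => (hmeas S).const_mul _]
  simp_rw [lintegral_const_mul _ (hmeas _)]
  refine (Finset.sum_le_sum fun S _ =>
    mul_le_mul_right (lintegral_eexp_separated_le σ S hu) _).trans (le_of_eq ?_)
  rw [← Finset.sum_mul, ← ENNReal.ofReal_sum_of_nonneg fun _ _ => hw0, hw1, ENNReal.ofReal_one,
    one_mul]

lemma lintegral_eexp_add_le {α : Type*} [MeasurableSpace α] {m : Measure α} {f g : α → ℝ}
    (hf : Measurable f) (hg : Measurable g) {F G : ℝ}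
    (hF : ∫⁻ a, eexp (2 * f a) ∂m ≤ eexp (2 * F)) (hG : ∫⁻ a, eexp (2 * g a) ∂m ≤ eexp (2 * G)) :
    ∫⁻ a, eexp (f a + g a) ∂m ≤ eexp (F + G) := by
  have h := ENNReal.lintegral_mul_le_Lp_mul_Lq m Real.HolderConjugate.two_two
    hf.eexp.aemeasurable hg.eexp.aemeasurable
  have hsq : ∀ x : ℝ, eexp x ^ (2 : ℝ) = eexp (2 * x) := by
    intro x
    rw [ENNReal.rpow_two, sq, ← eexp_add, two_mul]
  have hrt : ∀ x : ℝ, eexp (2 * x) ^ (1 / 2 : ℝ) = eexp x := by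
    intro x
    rw [← hsq, ← ENNReal.rpow_mul]; norm_num
  simp only [Pi.mul_apply, hsq] at h
  simp_rw [eexp_add]
  refine h.trans (mul_le_mul' ?_ ?_)
  · rw [← hrt F]; exact ENNReal.rpow_le_rpow hF (by norm_num)
  · rw [← hrt G]; exact ENNReal.rpow_le_rpow hG (by norm_num)

lemma lintegral_eexp_quadratic_le (σ : Equiv.Perm ι) (c : ι → ℝ) {u : ℝ}
    (hc : ∀ i, |c i| ≤ 1 / 8) (hu : 128 * u ^ 2 ≤ 1) :
    ∫⁻ a, eexp (∑ i, c i * a i ^ 2 + u * ∑ e ∈ σ.support, a e * a (σ e)) ∂(stdPi ι)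
      ≤ eexp (∑ i, (c i + 8 * c i ^ 2) + 32 * u ^ 2 * #σ.support) := by
  refine lintegral_eexp_add_le (by fun_prop) (by fun_prop) ?_ ?_
  · have h := lintegral_eexp_sq_stdPi_le (fun i => 2 * c i) (fun i => by
      rw [abs_mul, abs_two]; linarith [hc i])
    simp_rw [Finset.mul_sum, ← mul_assoc]
    refine h.trans (eexp_mono (Finset.sum_le_sum fun i _ => ?_))
    exact le_of_eq (by ring)
  · have h := lintegral_eexp_perm_le σ (u := 2 * u) (by nlinarith)
    simp_rw [← mul_assoc]
    refine h.trans (eexp_mono (le_of_eq (by ring)))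

end Quadratic

section Correlated

variable {ι : Type*}

/-- The signal-to-noise ratio of a pair of correlation `ρ`. -/
def snr (ρ : ℝ) : ℝ := ρ ^ 2 / (1 - ρ ^ 2)

/-- The second member of a `ρ`-correlated pair, as a function of the first member and the noise. -/
def corr (ρ : ℝ) (q : (ι → ℝ) × (ι → ℝ)) (e : ι) : ℝ := ρ * q.1 e + √(1 - ρ ^ 2) * q.2 e

/-- The weighted overlap along `T` after matching through `σ`. -/
def overlap (ρ : ℝ) (σ : Equiv.Perm ι) (T : Finset ι) (q : (ι → ℝ) × (ι → ℝ)) : ℝ :=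
  ρ / (1 - ρ ^ 2) * ∑ e ∈ T, corr ρ q (σ e) * q.1 e

lemma snr_nonneg {ρ : ℝ} (hρ : ρ ^ 2 ≤ 1) : 0 ≤ snr ρ :=
  div_nonneg (sq_nonneg _) (by linarith)

lemma coeff_mul_self (ρ : ℝ) : ρ / (1 - ρ ^ 2) * ρ = snr ρ := by rw [snr]; ring

lemma coeff_sq_mul (ρ : ℝ) : (ρ / (1 - ρ ^ 2)) ^ 2 * (1 - ρ ^ 2) = snr ρ := by
  rw [snr]
  by_cases h : 1 - ρ ^ 2 = 0
  · simp [h]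
  · field_simp

@[fun_prop]
lemma measurable_corr (ρ : ℝ) (e : ι) :
    Measurable fun q : (ι → ℝ) × (ι → ℝ) => corr ρ q e := by unfold corr; fun_prop

@[fun_prop]
lemma measurable_overlap (ρ : ℝ) (σ : Equiv.Perm ι) (T : Finset ι) :
    Measurable fun q : (ι → ℝ) × (ι → ℝ) => overlap ρ σ T q := by unfold overlap; fun_prop

variable [Fintype ι]

lemma lintegral_eexp_corr {ρ : ℝ} (hρ : ρ ^ 2 ≤ 1) (v : (ι → ℝ) → ι → ℝ)
    (hv : ∀ e, Measurable fun a => v a e) :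
    ∫⁻ q, eexp (∑ e, v q.1 e * corr ρ q e) ∂((stdPi ι).prod (stdPi ι))
      = ∫⁻ a, eexp (∑ e, (ρ * (v a e * a e) + (1 - ρ ^ 2) / 2 * v a e ^ 2)) ∂(stdPi ι) := by
  rw [lintegral_prod _ (by
    refine (Measurable.eexp ?_).aemeasurable
    exact Finset.measurable_sum _ fun e _ =>
      ((hv e).comp measurable_fst).mul (measurable_corr ρ e))]
  refine lintegral_congr fun a => ?_
  have h : ∀ z : ι → ℝ, eexp (∑ e, v a e * corr ρ (a, z) e)
      = eexp (∑ e, ρ * (v a e * a e)) * eexp (∑ e, (√(1 - ρ ^ 2) * v a e) * z e) := by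
    intro z
    rw [← eexp_add, ← Finset.sum_add_distrib]
    congr 1
    exact Finset.sum_congr rfl fun e _ => by simp only [corr]; ring
  simp_rw [h]
  rw [lintegral_const_mul _ (by fun_prop), lintegral_eexp_linear_stdPi, ← eexp_add,
    ← Finset.sum_add_distrib]
  congr 1
  refine Finset.sum_congr rfl fun e _ => ?_
  rw [mul_pow, Real.sq_sqrt (by linarith)]
  ring

variable [DecidableEq ι]

lemma sum_ite_mem_univ (T : Finset ι) (f : ι → ℝ) :
    (∑ e, if e ∈ T then f e else 0) = ∑ e ∈ T, f e := by
  rw [← Finset.sum_filter, Finset.filter_mem_eq_inter, Finset.univ_inter]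

/-- Integrating out the noise in an exponential that is linear in the correlated copy. -/
lemma lintegral_eexp_corr_on {ρ : ℝ} (hρ : ρ ^ 2 ≤ 1) (T : Finset ι) (w : (ι → ℝ) → ι → ℝ)
    (hw : ∀ e, Measurable fun a => w a e) :
    ∫⁻ q, eexp (ρ / (1 - ρ ^ 2) * ∑ e ∈ T, w q.1 e * corr ρ q e) ∂((stdPi ι).prod (stdPi ι))
      = ∫⁻ a, eexp (snr ρ * ∑ e ∈ T, (w a e * a e + w a e ^ 2 / 2)) ∂(stdPi ι) := by
  have h := lintegral_eexp_corr hρ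
    (fun a e => if e ∈ T then ρ / (1 - ρ ^ 2) * w a e else 0) (fun e => by
      by_cases he : e ∈ T
      · simpa [he] using (hw e).const_mul _
      · simp [he])
  have h1 : ∀ q : (ι → ℝ) × (ι → ℝ),
      ∑ e, (if e ∈ T then ρ / (1 - ρ ^ 2) * w q.1 e else 0) * corr ρ q e
        = ρ / (1 - ρ ^ 2) * ∑ e ∈ T, w q.1 e * corr ρ q e := by
    intro q
    simp_rw [ite_mul, zero_mul]
    rw [sum_ite_mem_univ, Finset.mul_sum]
    exact Finset.sum_congr rfl fun e _ => by ring
  have h2 : ∀ a : ι → ℝ,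
      ∑ e, (ρ * ((if e ∈ T then ρ / (1 - ρ ^ 2) * w a e else 0) * a e)
        + (1 - ρ ^ 2) / 2 * (if e ∈ T then ρ / (1 - ρ ^ 2) * w a e else 0) ^ 2)
        = snr ρ * ∑ e ∈ T, (w a e * a e + w a e ^ 2 / 2) := by
    intro a
    rw [Finset.mul_sum, ← sum_ite_mem_univ T fun e => snr ρ * (w a e * a e + w a e ^ 2 / 2)]
    refine Finset.sum_congr rfl fun e _ => ?_
    split_ifs
    · linear_combination (w a e * a e) * coeff_mul_self ρ + w a e ^ 2 / 2 * coeff_sq_mul ρ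
    · ring
  simp_rw [h1, h2] at h
  exact h

lemma overlap_eq_inv (ρ : ℝ) (σ : Equiv.Perm ι) {T : Finset ι} (hT : σ.support ⊆ T)
    (q : (ι → ℝ) × (ι → ℝ)) :
    overlap ρ σ T q = ρ / (1 - ρ ^ 2) * ∑ e ∈ T, q.1 (σ.symm e) * corr ρ q e := by
  rw [overlap, ← sum_perm_comp σ hT fun e => q.1 (σ.symm e) * corr ρ q e]
  simp_rw [Equiv.symm_apply_apply, mul_comm]

/-- Bhattacharyya-type bound for the comparison of `σ` with the identity. -/
lemma lintegral_eexp_half_overlap_le {ρ : ℝ} (hρ : ρ ^ 2 ≤ 1) (σ : Equiv.Perm ι) {x : ℝ}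
    (hx0 : 0 ≤ x) (hx : x ≤ snr ρ) (hx4 : x ≤ 1 / 4) :
    ∫⁻ q, eexp (-(overlap ρ 1 σ.support q - overlap ρ σ σ.support q) / 2)
        ∂((stdPi ι).prod (stdPi ι))
      ≤ eexp (-(x / 4 - 3 * x ^ 2) * #σ.support) := by
  have h1 : ∀ q : (ι → ℝ) × (ι → ℝ),
      -(overlap ρ 1 σ.support q - overlap ρ σ σ.support q) / 2
        = ρ / (1 - ρ ^ 2) * ∑ e ∈ σ.support, (-(q.1 e - q.1 (σ.symm e)) / 2) * corr ρ q e := by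
    intro q
    rw [overlap_eq_inv ρ σ subset_rfl, overlap, ← mul_sub, ← Finset.sum_sub_distrib,
      ← mul_neg, mul_div_assoc, ← Finset.sum_neg_distrib, Finset.sum_div]
    congr 1
    exact Finset.sum_congr rfl fun e _ => by simp only [Equiv.Perm.one_apply]; ring
  simp_rw [h1]
  rw [lintegral_eexp_corr_on hρ _ (fun a e => -(a e - a (σ.symm e)) / 2) (fun e => by fun_prop)]
  have h2 : ∀ a : ι → ℝ, snr ρ * ∑ e ∈ σ.support,
      ((-(a e - a (σ.symm e)) / 2) * a e + (-(a e - a (σ.symm e)) / 2) ^ 2 / 2)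
      ≤ ∑ e, (if e ∈ σ.support then -(x / 4) else 0) * a e ^ 2
        + x / 4 * ∑ e ∈ σ.support, a e * a (σ e) := by
    intro a
    have hsq : ∑ e ∈ σ.support, a (σ e) ^ 2 = ∑ e ∈ σ.support, a e ^ 2 :=
      sum_perm_comp σ subset_rfl fun e => a e ^ 2
    have hpos : 0 ≤ ∑ e ∈ σ.support, a e ^ 2 - ∑ e ∈ σ.support, a e * a (σ e) := by
      have : 0 ≤ ∑ e ∈ σ.support, (a (σ e) - a e) ^ 2 := Finset.sum_nonneg fun _ _ => sq_nonneg _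
      have h3 : ∑ e ∈ σ.support, (a (σ e) - a e) ^ 2
          = ∑ e ∈ σ.support, a (σ e) ^ 2 + ∑ e ∈ σ.support, a e ^ 2
            - 2 * ∑ e ∈ σ.support, a e * a (σ e) := by
        rw [Finset.mul_sum, ← Finset.sum_add_distrib, ← Finset.sum_sub_distrib]
        exact Finset.sum_congr rfl fun e _ => by ring
      linarith
    have h4 : ∑ e ∈ σ.support,
        ((-(a e - a (σ.symm e)) / 2) * a e + (-(a e - a (σ.symm e)) / 2) ^ 2 / 2)
        = -(1 / 4) * (∑ e ∈ σ.support, a e ^ 2 - ∑ e ∈ σ.support, a e * a (σ e)) := by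
      rw [← sum_perm_comp σ subset_rfl fun e =>
        (-(a e - a (σ.symm e)) / 2) * a e + (-(a e - a (σ.symm e)) / 2) ^ 2 / 2]
      simp_rw [Equiv.symm_apply_apply]
      have h5 : ∑ e ∈ σ.support, ((-(a (σ e) - a e) / 2) * a (σ e) + (-(a (σ e) - a e) / 2) ^ 2 / 2)
          = -(3 / 8) * ∑ e ∈ σ.support, a (σ e) ^ 2 + 1 / 8 * ∑ e ∈ σ.support, a e ^ 2
            + 1 / 4 * ∑ e ∈ σ.support, a e * a (σ e) := by
        rw [Finset.mul_sum, Finset.mul_sum, Finset.mul_sum, ← Finset.sum_add_distrib,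
          ← Finset.sum_add_distrib]
        exact Finset.sum_congr rfl fun e _ => by ring
      rw [h5, hsq]; ring
    rw [h4]
    simp_rw [ite_mul, zero_mul]
    rw [sum_ite_mem_univ, ← Finset.mul_sum]
    nlinarith [mul_le_mul_of_nonneg_right hx hpos]
  refine (lintegral_mono fun a => eexp_mono (h2 a)).trans
    ((lintegral_eexp_quadratic_le σ _ (fun e => ?_) (by nlinarith)).trans (eexp_mono ?_))
  · split_ifs
    · rw [abs_neg, abs_of_nonneg (by linarith)]; linarith
    · norm_num
  · have h6 : ∀ e, ((if e ∈ σ.support then -(x / 4) else 0)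
        + 8 * (if e ∈ σ.support then -(x / 4) else 0) ^ 2 : ℝ)
        = if e ∈ σ.support then -(x / 4) + x ^ 2 / 2 else 0 := by
      intro e
      split_ifs <;> ring
    simp_rw [h6]
    rw [sum_ite_mem_univ, Finset.sum_const, nsmul_eq_mul]
    have : 0 ≤ x ^ 2 * (#σ.support : ℝ) := by positivity
    nlinarith

/-- Lower-tail exponential moment of the overlap at the true matching. -/
lemma lintegral_eexp_neg_overlap_one_le {ρ θ : ℝ} (hρ : ρ ^ 2 ≤ 1) (T : Finset ι)
    (hθ0 : 0 ≤ θ) (hθ1 : θ ≤ 1) (hx : snr ρ ≤ 1 / 8) :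
    ∫⁻ q, eexp (-θ * overlap ρ 1 T q) ∂((stdPi ι).prod (stdPi ι))
      ≤ eexp ((-(θ - θ ^ 2 / 2) * snr ρ + 8 * snr ρ ^ 2) * #T) := by
  have hx0 := snr_nonneg hρ
  have h1 : ∀ q : (ι → ℝ) × (ι → ℝ), -θ * overlap ρ 1 T q
      = ρ / (1 - ρ ^ 2) * ∑ e ∈ T, (-θ * q.1 e) * corr ρ q e := by
    intro q
    rw [overlap, Finset.mul_sum, Finset.mul_sum, Finset.mul_sum]
    exact Finset.sum_congr rfl fun e _ => by simp only [Equiv.Perm.one_apply]; ring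
  simp_rw [h1]
  rw [lintegral_eexp_corr_on hρ _ (fun a e => -θ * a e) (fun e => by fun_prop)]
  have h2 : ∀ a : ι → ℝ, snr ρ * ∑ e ∈ T, (-θ * a e * a e + (-θ * a e) ^ 2 / 2)
      = ∑ e, (if e ∈ T then -(θ - θ ^ 2 / 2) * snr ρ else 0) * a e ^ 2
        + 0 * ∑ e ∈ (1 : Equiv.Perm ι).support, a e * a ((1 : Equiv.Perm ι) e) := by
    intro a
    simp_rw [ite_mul, zero_mul]
    rw [sum_ite_mem_univ, add_zero, Finset.mul_sum]
    exact Finset.sum_congr rfl fun e _ => by ring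
  simp_rw [h2]
  have hθ : |-(θ - θ ^ 2 / 2)| ≤ 1 := by rw [abs_le]; constructor <;> nlinarith
  have hc : |-(θ - θ ^ 2 / 2) * snr ρ| ≤ snr ρ := by
    rw [abs_mul, abs_of_nonneg hx0]; nlinarith
  refine (lintegral_eexp_quadratic_le 1 _ (fun e => ?_) (by norm_num)).trans (eexp_mono ?_)
  · split_ifs
    · exact hc.trans hx
    · norm_num
  · have h6 : ∀ e, ((if e ∈ T then -(θ - θ ^ 2 / 2) * snr ρ else 0)
        + 8 * (if e ∈ T then -(θ - θ ^ 2 / 2) * snr ρ else 0) ^ 2 : ℝ)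
        ≤ if e ∈ T then -(θ - θ ^ 2 / 2) * snr ρ + 8 * snr ρ ^ 2 else 0 := by
      intro e
      split_ifs
      · have := sq_le_sq' (abs_le.1 hc).1 (abs_le.1 hc).2
        linarith
      · norm_num
    have h7 := Finset.sum_le_sum fun e (_ : e ∈ Finset.univ) => h6 e
    rw [sum_ite_mem_univ, Finset.sum_const, nsmul_eq_mul] at h7
    linarith

/-- Exponential moment of the overlap at a wrong matching. -/
lemma lintegral_eexp_overlap_le {ρ : ℝ} (hρ : ρ ^ 2 ≤ 1) (σ : Equiv.Perm ι) {T : Finset ι}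
    (hT : σ.support ⊆ T) (hx : snr ρ ≤ 1 / 12) :
    ∫⁻ q, eexp (overlap ρ σ T q) ∂((stdPi ι).prod (stdPi ι))
      ≤ eexp (snr ρ / 2 * #T + snr ρ * #(T \ σ.support) + 50 * snr ρ ^ 2 * #T) := by
  have hx0 := snr_nonneg hρ
  simp_rw [overlap_eq_inv ρ σ hT]
  rw [lintegral_eexp_corr_on hρ _ (fun a e => a (σ.symm e)) (fun e => by fun_prop)]
  have h2 : ∀ a : ι → ℝ, snr ρ * ∑ e ∈ T, (a (σ.symm e) * a e + a (σ.symm e) ^ 2 / 2)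
      = ∑ e, (if e ∈ T then (if e ∈ σ.support then snr ρ / 2 else 3 / 2 * snr ρ) else 0) * a e ^ 2
        + snr ρ * ∑ e ∈ σ.support, a e * a (σ e) := by
    intro a
    rw [← sum_perm_comp σ hT fun e => a (σ.symm e) * a e + a (σ.symm e) ^ 2 / 2]
    simp_rw [Equiv.symm_apply_apply, ite_mul, zero_mul]
    rw [sum_ite_mem_univ, ← Finset.sum_sdiff hT, ← Finset.sum_sdiff hT, mul_add, Finset.mul_sum,
      Finset.mul_sum, Finset.mul_sum, add_assoc, ← Finset.sum_add_distrib]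
    congr 1
    · refine Finset.sum_congr rfl fun e he => ?_
      have he' := (Finset.mem_sdiff.1 he).2
      rw [if_neg he', Equiv.Perm.notMem_support.1 he']; ring
    · refine Finset.sum_congr rfl fun e he => ?_
      rw [if_pos he]; ring
  simp_rw [h2]
  refine (lintegral_eexp_quadratic_le σ _ (fun e => ?_) (by nlinarith)).trans (eexp_mono ?_)
  · split_ifs
    · rw [abs_of_nonneg (by linarith)]; linarith
    · rw [abs_of_nonneg (by linarith)]; linarith
    · norm_num
  · have h6 : ∀ e, ((if e ∈ T then (if e ∈ σ.support then snr ρ / 2 else 3 / 2 * snr ρ) else 0)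
        + 8 * (if e ∈ T then (if e ∈ σ.support then snr ρ / 2 else 3 / 2 * snr ρ) else 0) ^ 2 : ℝ)
        ≤ (if e ∈ T then snr ρ / 2 + 18 * snr ρ ^ 2 else 0)
          + (if e ∈ T \ σ.support then snr ρ else 0) := by
      intro e
      by_cases h : e ∈ T <;> by_cases h' : e ∈ σ.support <;> simp only [h, h', Finset.mem_sdiff,
        if_true, if_false, not_true, not_false_iff, and_true, and_false] <;> nlinarith
    have h7 := Finset.sum_le_sum fun e (_ : e ∈ Finset.univ) => h6 e
    have h8 : ∑ e, ((if e ∈ T then snr ρ / 2 + 18 * snr ρ ^ 2 else 0)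
        + (if e ∈ T \ σ.support then snr ρ else 0))
        = #T * (snr ρ / 2 + 18 * snr ρ ^ 2) + #(T \ σ.support) * snr ρ := by
      rw [Finset.sum_add_distrib, sum_ite_mem_univ, sum_ite_mem_univ, Finset.sum_const,
        Finset.sum_const, nsmul_eq_mul, nsmul_eq_mul]
    rw [h8] at h7
    have hcard : (#σ.support : ℝ) ≤ #T := by exact_mod_cast Finset.card_le_card hT
    have : snr ρ ^ 2 * (#σ.support : ℝ) ≤ snr ρ ^ 2 * #T :=
      mul_le_mul_of_nonneg_left hcard (sq_nonneg _)
    nlinarith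

end Correlated

lemma measurePreserving_uncurry_stdGaussF (n d : ℕ) :
    MeasurePreserving (fun f : FW n d => fun p : Fin n × Fin d => f p.1 p.2)
      (stdGaussF n d) (stdPi (Fin n × Fin d)) := by
  have hm : Measurable (fun f : FW n d => fun p : Fin n × Fin d => f p.1 p.2) := by fun_prop
  refine ⟨hm, ?_⟩
  rw [stdPi]
  refine (Measure.pi_eq fun s hs => ?_).symm
  rw [Measure.map_apply hm (MeasurableSet.univ_pi hs)]
  have hpre : (fun f : FW n d => fun p : Fin n × Fin d => f p.1 p.2) ⁻¹' (Set.univ.pi s)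
      = Set.univ.pi fun i => Set.univ.pi fun j => s (i, j) := by
    ext f
    simp
  rw [hpre, stdGaussF, Measure.pi_pi]
  simp_rw [Measure.pi_pi]
  rw [Fintype.prod_prod_type]

section Model

variable {n d : ℕ}

/-- The graph part of a sample, indexed by ordered pairs of vertices. -/
def graphPart (ω : Samp n d) : (Fin n × Fin n → ℝ) × (Fin n × Fin n → ℝ) :=
  (fun p => ω.1.1 p.1 p.2, fun p => ω.1.2 p.1 p.2)

/-- The feature part of a sample, indexed by pairs (user, feature). -/
def featPart (ω : Samp n d) : (Fin n × Fin d → ℝ) × (Fin n × Fin d → ℝ) :=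
  (fun p => ω.2.1 p.1 p.2, fun p => ω.2.2 p.1 p.2)

@[fun_prop]
lemma measurable_graphPart : Measurable (graphPart : Samp n d → _) := by
  unfold graphPart; fun_prop

@[fun_prop]
lemma measurable_featPart : Measurable (featPart : Samp n d → _) := by
  unfold featPart; fun_prop

instance : IsProbabilityMeasure (stdGaussF n d) := by unfold stdGaussF; infer_instance

instance : IsProbabilityMeasure (stdGaussG n) := by unfold stdGaussG; infer_instance

lemma lintegral_eexp_parts {f : (Fin n × Fin n → ℝ) × (Fin n × Fin n → ℝ) → ℝ}
    {g : (Fin n × Fin d → ℝ) × (Fin n × Fin d → ℝ) → ℝ} (hf : Measurable f) (hg : Measurable g) :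
    ∫⁻ ω, eexp (f (graphPart ω) + g (featPart ω)) ∂(μ n d)
      = (∫⁻ q, eexp (f q) ∂((stdPi _).prod (stdPi _)))
        * ∫⁻ q, eexp (g q) ∂((stdPi _).prod (stdPi _)) := by
  have hG : MeasurePreserving (fun f : GW n => fun p : Fin n × Fin n => f p.1 p.2)
      (stdGaussG n) (stdPi (Fin n × Fin n)) := measurePreserving_uncurry_stdGaussF n n
  have hF := measurePreserving_uncurry_stdGaussF n d
  rw [← (hG.prod hG).lintegral_comp hf.eexp, ← (hF.prod hF).lintegral_comp hg.eexp, μ,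
    ← lintegral_prod_mul (by fun_prop) (by fun_prop)]
  exact lintegral_congr fun ω => eexp_add _ _

/-- The permutation of ordered pairs `i < j` induced by a permutation of the vertices;
pairs with `j ≤ i` are fixed. -/
def edgePerm (φ : Equiv.Perm (Fin n)) : Equiv.Perm (Fin n × Fin n) where
  toFun p := if p.1 < p.2 then (min (φ p.1) (φ p.2), max (φ p.1) (φ p.2)) else p
  invFun p := if p.1 < p.2 then (min (φ.symm p.1) (φ.symm p.2), max (φ.symm p.1) (φ.symm p.2))
    else p
  left_inv p := by
    by_cases h : p.1 < p.2
    · have hne : φ p.1 ≠ φ p.2 := fun h' => h.ne (φ.injective h')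
      rcases hne.lt_or_gt with h' | h' <;> simp [h, h', h'.le, h.le]
    · simp [h]
  right_inv p := by
    by_cases h : p.1 < p.2
    · have hne : φ.symm p.1 ≠ φ.symm p.2 := fun h' => h.ne (φ.symm.injective h')
      rcases hne.lt_or_gt with h' | h' <;> simp [h, h', h'.le, h.le]
    · simp [h]

lemma edgePerm_apply (φ : Equiv.Perm (Fin n)) {p : Fin n × Fin n} (h : p.1 < p.2) :
    edgePerm φ p = (min (φ p.1) (φ p.2), max (φ p.1) (φ p.2)) := if_pos h

lemma edgePerm_eq_self_iff (φ : Equiv.Perm (Fin n)) {p : Fin n × Fin n} (h : p.1 < p.2) :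
    edgePerm φ p = p ↔ (φ p.1 = p.1 ∧ φ p.2 = p.2) ∨ (φ p.1 = p.2 ∧ φ p.2 = p.1) := by
  have hne : φ p.1 ≠ φ p.2 := fun h' => h.ne (φ.injective h')
  rw [edgePerm_apply φ h, Prod.ext_iff]
  rcases hne.lt_or_gt with h' | h'
  · simp only [min_eq_left h'.le, max_eq_right h'.le]
    refine ⟨Or.inl, ?_⟩
    rintro (h1 | ⟨h1, h2⟩)
    · exact h1
    · rw [h1, h2] at h'; exact absurd h' h.asymm
  · simp only [min_eq_right h'.le, max_eq_left h'.le]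
    refine ⟨fun h1 => Or.inr h1.symm, ?_⟩
    rintro (⟨h1, h2⟩ | h1)
    · rw [h1, h2] at h'; exact absurd h' h.asymm
    · exact h1.symm

lemma movedEdges_eq_support (φ : Equiv.Perm (Fin n)) : movedEdges φ = (edgePerm φ).support := by
  ext p
  rw [Equiv.Perm.mem_support, movedEdges, Finset.mem_filter]
  by_cases h : p.1 < p.2
  · rw [ne_eq, edgePerm_eq_self_iff φ h]
    simp [h]
  · have : edgePerm φ p = p := if_neg h
    simp [h, this]

/-- The permutation of (user, feature) pairs induced by a permutation of the users. -/
def featPerm (d : ℕ) (φ : Equiv.Perm (Fin n)) : Equiv.Perm (Fin n × Fin d) :=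
  Equiv.prodCongr φ (Equiv.refl _)

lemma support_featPerm (φ : Equiv.Perm (Fin n)) :
    (featPerm d φ).support = φ.support ×ˢ Finset.univ := by
  ext p
  simp [featPerm, Prod.ext_iff]

lemma sum_moved_eq_overlap (ρ : ℝ) (φ : Equiv.Perm (Fin n)) {S : Finset (Fin n × Fin n)}
    (hS : ∀ p ∈ S, p.1 < p.2) (ω : Samp n d) :
    ρ / (1 - ρ ^ 2) * ∑ p ∈ S, Bmat ρ ω (φ p.1) (φ p.2) * Amat ω p.1 p.2
      = overlap ρ (edgePerm φ) S (graphPart ω) := by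
  rw [overlap]
  congr 1
  refine Finset.sum_congr rfl fun p hp => ?_
  have h := hS p hp
  have hne : φ p.1 ≠ φ p.2 := fun h' => h.ne (φ.injective h')
  rw [edgePerm_apply φ h]
  rcases hne.lt_or_gt with h' | h'
  · simp [Bmat, Amat, sym, corr, graphPart, h.le, h'.le]
  · simp [Bmat, Amat, sym, corr, graphPart, h.le, h'.le, h'.not_ge]

lemma overlap_one_edgePerm (ρ : ℝ) {S : Finset (Fin n × Fin n)} (hS : ∀ p ∈ S, p.1 < p.2)
    (q : (Fin n × Fin n → ℝ) × (Fin n × Fin n → ℝ)) :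
    overlap ρ (edgePerm 1) S q = overlap ρ 1 S q := by
  rw [overlap, overlap]
  congr 1
  refine Finset.sum_congr rfl fun p hp => ?_
  rw [edgePerm_apply 1 (hS p hp)]
  simp [(hS p hp).le]

lemma lt_of_mem_support_edgePerm {φ : Equiv.Perm (Fin n)} {p : Fin n × Fin n}
    (hp : p ∈ (edgePerm φ).support) : p.1 < p.2 := by
  by_contra h
  exact (Equiv.Perm.mem_support.1 hp) (if_neg h)

lemma V_eq_overlap (ρ η : ℝ) (φ : Equiv.Perm (Fin n)) (ω : Samp n d) :
    V ρ η φ ω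
      = (overlap ρ 1 (edgePerm φ).support (graphPart ω)
          - overlap ρ (edgePerm φ) (edgePerm φ).support (graphPart ω))
        + (overlap η 1 (featPerm d φ).support (featPart ω)
          - overlap η (featPerm d φ) (featPerm d φ).support (featPart ω)) := by
  have hS : ∀ p ∈ (edgePerm φ).support, p.1 < p.2 := fun p hp => lt_of_mem_support_edgePerm hp
  have h1 := sum_moved_eq_overlap ρ φ hS ω
  have h2 := sum_moved_eq_overlap ρ 1 hS ω
  rw [overlap_one_edgePerm ρ hS] at h2
  have h3 : η / (1 - η ^ 2) * VF η φ ω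
      = overlap η (featPerm d φ) (featPerm d φ).support (featPart ω) := by
    rw [support_featPerm, overlap, VF, Finset.sum_product]; rfl
  have h4 : η / (1 - η ^ 2) * VFstar η φ ω
      = overlap η 1 (featPerm d φ).support (featPart ω) := by
    rw [support_featPerm, overlap, VFstar, Finset.sum_product]; rfl
  rw [← h1, ← h2, ← h3, ← h4, V, VGstar, VG, movedEdges_eq_support]
  simp only [Equiv.Perm.one_apply]
  ring

lemma overlap_sub_eq_of_subset {ι : Type*} [Fintype ι] [DecidableEq ι] (ρ : ℝ)
    (σ : Equiv.Perm ι) {T : Finset ι} (hT : σ.support ⊆ T) (q : (ι → ℝ) × (ι → ℝ)) :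
    overlap ρ 1 σ.support q - overlap ρ σ σ.support q = overlap ρ 1 T q - overlap ρ σ T q := by
  simp only [overlap, ← mul_sub, ← Finset.sum_sub_distrib]
  congr 1
  refine Finset.sum_subset hT fun e _ he => ?_
  rw [Equiv.Perm.notMem_support.1 he]; simp

/-- The pairs `i < j` with at least one end in `K`. -/
def touching (K : Finset (Fin n)) : Finset (Fin n × Fin n) :=
  Finset.univ.filter fun p => p.1 < p.2 ∧ (p.1 ∈ K ∨ p.2 ∈ K)

lemma support_edgePerm_subset (φ : Equiv.Perm (Fin n)) :
    (edgePerm φ).support ⊆ touching φ.support := by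
  intro p hp
  have h := lt_of_mem_support_edgePerm hp
  rw [Equiv.Perm.mem_support, ne_eq, edgePerm_eq_self_iff φ h, not_or] at hp
  rw [touching, Finset.mem_filter, Equiv.Perm.mem_support, Equiv.Perm.mem_support]
  exact ⟨Finset.mem_univ _, h, not_and_or.1 hp.1⟩

lemma two_mul_card_lt_filter (s : Finset (Fin n)) :
    2 * #(s.offDiag.filter fun p => p.1 < p.2) = #s.offDiag := by
  have h1 : #(s.offDiag.filter fun p => ¬ p.1 < p.2) = #(s.offDiag.filter fun p => p.1 < p.2) := by
    refine Finset.card_nbij' Prod.swap Prod.swap ?_ ?_ (fun _ _ => rfl) (fun _ _ => rfl)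
    · intro p hp
      simp only [Finset.coe_filter, Finset.mem_offDiag, Set.mem_ofPred_eq, Prod.fst_swap,
        Prod.snd_swap, not_lt] at hp ⊢
      exact ⟨⟨hp.1.2.1, hp.1.1, hp.1.2.2.symm⟩, lt_of_le_of_ne hp.2 hp.1.2.2.symm⟩
    · intro p hp
      simp only [Finset.coe_filter, Finset.mem_offDiag, Set.mem_ofPred_eq, Prod.fst_swap,
        Prod.snd_swap, not_lt] at hp ⊢
      exact ⟨⟨hp.1.2.1, hp.1.1, hp.1.2.2.symm⟩, hp.2.le⟩
  have h2 := Finset.card_filter_add_card_filter_not (s := s.offDiag) (fun p => p.1 < p.2)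
  omega

lemma card_touching (K : Finset (Fin n)) :
    (#(touching K) : ℝ) = #K * (n - (#K + 1) / 2) := by
  have h1 : #(touching K) + #((Kᶜ).offDiag.filter fun p => p.1 < p.2)
      = #((Finset.univ : Finset (Fin n)).offDiag.filter fun p => p.1 < p.2) := by
    rw [← Finset.card_union_of_disjoint]
    · congr 1
      ext p
      simp only [touching, Finset.mem_union, Finset.mem_filter, Finset.mem_univ, true_and,
        Finset.mem_offDiag, Finset.mem_compl]
      have : p.1 < p.2 → p.1 ≠ p.2 := fun h => h.ne
      tauto
    · rw [Finset.disjoint_left]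
      intro p hp hp'
      simp only [touching, Finset.mem_filter, Finset.mem_univ, true_and,
        Finset.mem_offDiag, Finset.mem_compl] at hp hp'
      tauto
  have h2 := two_mul_card_lt_filter (Kᶜ)
  have h3 := two_mul_card_lt_filter (Finset.univ : Finset (Fin n))
  rw [Finset.offDiag_card, Finset.card_compl, Fintype.card_fin] at h2
  rw [Finset.offDiag_card, Finset.card_univ, Fintype.card_fin] at h3
  have hK : #K ≤ n := by simpa using Finset.card_le_univ K
  obtain ⟨m, hm⟩ := Nat.exists_eq_add_of_le hK
  have hm' : n - #K = m := by omega
  rw [hm'] at h2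
  have hmm : m ≤ m * m := Nat.le_mul_self m
  have hnn : n ≤ n * n := Nat.le_mul_self n
  have h1' : (#(touching K) : ℝ) + (#((Kᶜ).offDiag.filter fun p => p.1 < p.2) : ℝ)
      = (#((Finset.univ : Finset (Fin n)).offDiag.filter fun p => p.1 < p.2) : ℝ) := by
    exact_mod_cast h1
  have h2' : 2 * (#((Kᶜ).offDiag.filter fun p => p.1 < p.2) : ℝ) = m * m - m := by
    rw [eq_sub_iff_add_eq]; norm_cast; omega
  have h3' : 2 * (#((Finset.univ : Finset (Fin n)).offDiag.filter fun p => p.1 < p.2) : ℝ)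
      = n * n - n := by
    rw [eq_sub_iff_add_eq]; norm_cast; omega
  have hn : (n : ℝ) = #K + m := by exact_mod_cast hm
  rw [hn] at h3' ⊢
  linarith

lemma card_touching_sdiff_le (φ : Equiv.Perm (Fin n)) :
    #(touching φ.support \ (edgePerm φ).support) ≤ #φ.support := by
  have key : ∀ p ∈ touching φ.support \ (edgePerm φ).support, φ p.1 = p.2 ∧ p.1 ∈ φ.support := by
    intro p hp
    rw [Finset.mem_sdiff, touching, Finset.mem_filter, Equiv.Perm.notMem_support] at hp
    obtain ⟨⟨-, h, h1⟩, h2⟩ := hp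
    rw [Equiv.Perm.mem_support, Equiv.Perm.mem_support] at h1
    rw [edgePerm_eq_self_iff φ h] at h2
    rcases h2 with h2 | h2
    · tauto
    · exact ⟨h2.1, by rw [Equiv.Perm.mem_support, h2.1]; exact h.ne'⟩
  refine Finset.card_le_card_of_injOn Prod.fst (fun p hp => (key p hp).2) ?_
  intro p hp p' hp' h
  refine Prod.ext h ?_
  rw [← (key p hp).1, ← (key p' hp').1, h]

lemma card_support_edgePerm_ge (φ : Equiv.Perm (Fin n)) :
    (#φ.support : ℝ) * (n - (#φ.support + 3) / 2) ≤ #(edgePerm φ).support := by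
  have h1 := Finset.card_sdiff_add_card_eq_card (support_edgePerm_subset φ)
  have h2 := card_touching_sdiff_le φ
  have h3 : (#(touching φ.support) : ℝ) ≤ #φ.support + #(edgePerm φ).support := by
    exact_mod_cast (by omega)
  rw [card_touching] at h3
  linarith

end Model

lemma measure_nonneg_le_lintegral_eexp {α : Type*} [MeasurableSpace α] (m : Measure α)
    {f : α → ℝ} (hf : Measurable f) : m {a | 0 ≤ f a} ≤ ∫⁻ a, eexp (f a) ∂m := by
  have h := mul_meas_ge_le_lintegral (μ := m) hf.eexp 1
  rw [one_mul] at h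
  refine le_trans (measure_mono fun a ha => ?_) h
  have : eexp 0 ≤ eexp (f a) := eexp_mono ha
  rwa [eexp_zero] at this

section Count

variable {n : ℕ}

lemma card_perm_support_subset (S : Finset (Fin n)) :
    #{φ : Equiv.Perm (Fin n) | φ.support ⊆ S} = (#S).factorial := by
  have h := Fintype.card_congr (Equiv.Perm.subtypeEquivSubtypePerm fun a : Fin n => a ∈ S)
  rw [Fintype.card_perm, Fintype.card_coe, Fintype.card_subtype] at h
  rw [h]
  congr 1
  ext φ
  simp only [Finset.mem_filter, Finset.mem_univ, true_and, Finset.subset_iff,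
    Equiv.Perm.mem_support]
  exact forall_congr' fun a => by tauto

lemma card_perm_card_support_le (t : ℕ) :
    #{φ : Equiv.Perm (Fin n) | #φ.support = t} ≤ n ^ t := by
  have hsub : (Finset.univ.filter fun φ : Equiv.Perm (Fin n) => #φ.support = t)
      ⊆ (Finset.univ.powersetCard t).biUnion
        fun S => Finset.univ.filter fun φ : Equiv.Perm (Fin n) => φ.support ⊆ S := by
    intro φ hφ
    rw [Finset.mem_filter] at hφ
    rw [Finset.mem_biUnion]
    exact ⟨φ.support, Finset.mem_powersetCard.2 ⟨Finset.subset_univ _, hφ.2⟩, by simp⟩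
  refine (Finset.card_le_card hsub).trans (Finset.card_biUnion_le.trans ?_)
  rw [Finset.sum_congr rfl fun S hS => by
    rw [card_perm_support_subset, (Finset.mem_powersetCard.1 hS).2]]
  rw [Finset.sum_const, Finset.card_powersetCard, Finset.card_univ, Fintype.card_fin, smul_eq_mul,
    mul_comm, ← Nat.descFactorial_eq_factorial_mul_choose]
  exact Nat.descFactorial_le_pow n t

lemma sum_perm_pow_card_support_le {z : ℝ} (hz0 : 0 ≤ z) (hz : z ≤ 1 / 2) :
    ∑ φ : Equiv.Perm (Fin n) with 2 ≤ #φ.support, (z / n) ^ #φ.support ≤ 2 * z ^ 2 := by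
  have hmaps : ∀ φ ∈ (Finset.univ.filter fun φ : Equiv.Perm (Fin n) => 2 ≤ #φ.support),
      #φ.support ∈ Finset.Ico 2 (n + 1) := by
    intro φ hφ
    rw [Finset.mem_Ico]
    refine ⟨(Finset.mem_filter.1 hφ).2, Nat.lt_succ_of_le ?_⟩
    simpa using Finset.card_le_univ φ.support
  rw [← Finset.sum_fiberwise_of_maps_to hmaps]
  have hterm : ∀ t ∈ Finset.Ico 2 (n + 1),
      ∑ φ ∈ (Finset.univ.filter fun φ : Equiv.Perm (Fin n) => 2 ≤ #φ.support) with
        #φ.support = t, (z / n) ^ #φ.support ≤ z ^ t := by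
    intro t _
    rw [Finset.sum_congr rfl fun φ hφ => by rw [(Finset.mem_filter.1 hφ).2], Finset.sum_const,
      nsmul_eq_mul]
    have h1 : #(Finset.filter (fun φ : Equiv.Perm (Fin n) => #φ.support = t)
        (Finset.univ.filter fun φ : Equiv.Perm (Fin n) => 2 ≤ #φ.support)) ≤ n ^ t :=
      (Finset.card_le_card (Finset.filter_subset_filter _ (Finset.subset_univ _))).trans
        (card_perm_card_support_le t)
    have h2 : 0 ≤ (z / n) ^ t := by positivity
    refine (mul_le_mul_of_nonneg_right (Nat.cast_le.2 h1) h2).trans ?_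
    rw [Nat.cast_pow, ← mul_pow]
    refine pow_le_pow_left₀ (by positivity) ?_ t
    by_cases hn : (n : ℝ) = 0
    · simp [hn, hz0]
    · rw [mul_div_cancel₀ _ hn]
  refine (Finset.sum_le_sum hterm).trans ?_
  have h3 := geom_sum_Ico_le_of_lt_one (m := 2) (n := n + 1) hz0 (by linarith)
  refine h3.trans ?_
  rw [div_le_iff₀ (by linarith)]
  nlinarith [sq_nonneg z]

end Count

section Tail

variable {n d : ℕ}

/-- The total overlap of the model on the edges touching `K` and the features of `K`. -/
def totalOverlap (ρ η : ℝ) (φ : Equiv.Perm (Fin n)) (K : Finset (Fin n)) (ω : Samp n d) : ℝ :=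
  overlap ρ (edgePerm φ) (touching K) (graphPart ω)
    + overlap η (featPerm d φ) (K ×ˢ Finset.univ) (featPart ω)

/-- The leading order of the expected overlap at the true matching. -/
def signal (ρ η : ℝ) (d : ℕ) (K : Finset (Fin n)) : ℝ :=
  snr ρ * #(touching K) + snr η * (#K * d)

lemma V_eq_totalOverlap_sub (ρ η : ℝ) (φ : Equiv.Perm (Fin n)) (ω : Samp n d) :
    V ρ η φ ω = totalOverlap ρ η 1 φ.support ω - totalOverlap ρ η φ φ.support ω := by
  rw [V_eq_overlap, overlap_sub_eq_of_subset ρ _ (support_edgePerm_subset φ), support_featPerm,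
    totalOverlap, totalOverlap, overlap_one_edgePerm ρ fun p hp => (Finset.mem_filter.1 hp).2.1]
  have : featPerm d (1 : Equiv.Perm (Fin n)) = 1 := by ext p <;> rfl
  rw [this]
  ring

lemma measure_V_neg_le {ρ η κ : ℝ} (hρ : ρ ^ 2 ≤ 1) (hη : η ^ 2 ≤ 1) (hκ0 : 0 ≤ κ)
    (hκ : κ ≤ 1 / 12) (φ : Equiv.Perm (Fin n)) :
    μ n d {ω | V ρ η φ ω < 0} ≤ eexp (-((1 - 12 * κ) / 4 *
      (min (snr ρ) κ * #(edgePerm φ).support + min (snr η) κ * (#φ.support * d)))) := by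
  have hm : Measurable fun ω : Samp n d => -V ρ η φ ω / 2 := by
    simp_rw [V_eq_overlap]; fun_prop
  have hsub : {ω : Samp n d | V ρ η φ ω < 0} ⊆ {ω | 0 ≤ -V ρ η φ ω / 2} := by
    intro ω hω
    simp only [Set.mem_ofPred_eq] at hω ⊢
    linarith
  refine (measure_mono hsub).trans ((measure_nonneg_le_lintegral_eexp _ hm).trans ?_)
  have hsplit : ∀ ω : Samp n d, -V ρ η φ ω / 2
      = -(overlap ρ 1 (edgePerm φ).support (graphPart ω)
          - overlap ρ (edgePerm φ) (edgePerm φ).support (graphPart ω)) / 2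
        + -(overlap η 1 (featPerm d φ).support (featPart ω)
          - overlap η (featPerm d φ) (featPerm d φ).support (featPart ω)) / 2 := by
    intro ω; rw [V_eq_overlap]; ring
  simp_rw [hsplit]
  have hprod := lintegral_eexp_parts (n := n) (d := d)
    (f := fun q => -(overlap ρ 1 (edgePerm φ).support q
      - overlap ρ (edgePerm φ) (edgePerm φ).support q) / 2)
    (g := fun q => -(overlap η 1 (featPerm d φ).support q
      - overlap η (featPerm d φ) (featPerm d φ).support q) / 2) (by fun_prop) (by fun_prop)
  rw [hprod]
  have hmin : ∀ {r : ℝ}, r ^ 2 ≤ 1 → 0 ≤ min (snr r) κ := fun hr => le_min (snr_nonneg hr) hκ0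
  refine (mul_le_mul'
    (lintegral_eexp_half_overlap_le hρ (edgePerm φ) (hmin hρ) (min_le_left _ _)
      ((min_le_right _ _).trans (by linarith)))
    (lintegral_eexp_half_overlap_le hη (featPerm d φ) (hmin hη) (min_le_left _ _)
      ((min_le_right _ _).trans (by linarith)))).trans ?_
  rw [← eexp_add]
  refine eexp_mono ?_
  have hone : ∀ {x m : ℝ}, 0 ≤ x → x ≤ κ → 0 ≤ m →
      -(x / 4 - 3 * x ^ 2) * m ≤ -((1 - 12 * κ) / 4 * (x * m)) := by
    intro x m hx0 hx hm
    nlinarith [mul_nonneg (mul_nonneg hx0 (sub_nonneg.2 hx)) hm]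
  have h1 := hone (m := #(edgePerm φ).support) (hmin hρ) (min_le_right _ _) (by positivity)
  have h2 := hone (m := #φ.support * d) (hmin hη) (min_le_right _ _) (by positivity)
  have h3 : (#(featPerm d φ).support : ℝ) = #φ.support * d := by
    rw [support_featPerm, Finset.card_product]; simp
  rw [h3]
  linarith

lemma measure_totalOverlap_one_le {ρ η κ δ : ℝ} (hρ : ρ ^ 2 ≤ 1) (hη : η ^ 2 ≤ 1)
    (hκ : κ ≤ 1 / 12) (hρκ : snr ρ ≤ κ) (hηκ : snr η ≤ κ) (hδ0 : 0 ≤ δ) (hδ1 : δ ≤ 1)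
    (K : Finset (Fin n)) :
    μ n d {ω | totalOverlap ρ η 1 K ω ≤ (1 - δ) * signal ρ η d K}
      ≤ eexp (-((δ ^ 2 / 2 - 8 * κ) * signal ρ η d K)) := by
  have hm : Measurable fun ω : Samp n d =>
      δ * ((1 - δ) * signal ρ η d K - totalOverlap ρ η 1 K ω) := by
    unfold totalOverlap; fun_prop
  have hsub : {ω : Samp n d | totalOverlap ρ η 1 K ω ≤ (1 - δ) * signal ρ η d K}
      ⊆ {ω | 0 ≤ δ * ((1 - δ) * signal ρ η d K - totalOverlap ρ η 1 K ω)} := by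
    intro ω hω
    simp only [Set.mem_ofPred_eq] at hω ⊢
    exact mul_nonneg hδ0 (by linarith)
  refine (measure_mono hsub).trans ((measure_nonneg_le_lintegral_eexp _ hm).trans ?_)
  have hfeat : featPerm d (1 : Equiv.Perm (Fin n)) = 1 := by ext p <;> rfl
  have hsplit : ∀ ω : Samp n d, δ * ((1 - δ) * signal ρ η d K - totalOverlap ρ η 1 K ω)
      = (δ * (1 - δ) * signal ρ η d K + -δ * overlap ρ 1 (touching K) (graphPart ω))
        + -δ * overlap η 1 (K ×ˢ Finset.univ) (featPart ω) := by
    intro ω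
    rw [totalOverlap, overlap_one_edgePerm ρ fun p hp => (Finset.mem_filter.1 hp).2.1, hfeat]
    ring
  simp_rw [hsplit]
  have hprod := lintegral_eexp_parts (n := n) (d := d)
    (f := fun q => δ * (1 - δ) * signal ρ η d K + -δ * overlap ρ 1 (touching K) q)
    (g := fun q => -δ * overlap η 1 (K ×ˢ Finset.univ) q) (by fun_prop) (by fun_prop)
  rw [hprod]
  simp_rw [eexp_add]
  rw [lintegral_const_mul _ (by fun_prop)]
  refine (mul_le_mul' (mul_le_mul_right (lintegral_eexp_neg_overlap_one_le hρ _ hδ0 hδ1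
    (by linarith)) _) (lintegral_eexp_neg_overlap_one_le hη _ hδ0 hδ1 (by linarith))).trans ?_
  rw [← eexp_add, ← eexp_add]
  refine eexp_mono ?_
  have hone : ∀ {x m : ℝ}, 0 ≤ x → x ≤ κ → 0 ≤ m →
      (-(δ - δ ^ 2 / 2) * x + 8 * x ^ 2) * m
        ≤ -(δ - δ ^ 2 / 2 - 8 * κ) * (x * m) := by
    intro x m hx0 hx hm
    nlinarith [mul_nonneg (mul_nonneg hx0 (sub_nonneg.2 hx)) hm]
  have h1 := hone (m := #(touching K)) (snr_nonneg hρ) hρκ (by positivity)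
  have h2 := hone (m := #K * d) (snr_nonneg hη) hηκ (by positivity)
  have h3 : (#(K ×ˢ (Finset.univ : Finset (Fin d))) : ℝ) = #K * d := by
    rw [Finset.card_product]; simp
  rw [h3]
  unfold signal
  linarith

lemma measure_totalOverlap_ge {ρ η κ δ : ℝ} (hρ : ρ ^ 2 ≤ 1) (hη : η ^ 2 ≤ 1)
    (hκ : κ ≤ 1 / 12) (hρκ : snr ρ ≤ κ) (hηκ : snr η ≤ κ) (φ : Equiv.Perm (Fin n)) :
    μ n d {ω | (1 - δ) * signal ρ η d φ.support ≤ totalOverlap ρ η φ φ.support ω}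
      ≤ eexp (-((1 / 2 - δ - 50 * κ) * signal ρ η d φ.support) + snr ρ * #φ.support) := by
  have hm : Measurable fun ω : Samp n d =>
      totalOverlap ρ η φ φ.support ω - (1 - δ) * signal ρ η d φ.support := by
    unfold totalOverlap; fun_prop
  have hsub : {ω : Samp n d | (1 - δ) * signal ρ η d φ.support ≤ totalOverlap ρ η φ φ.support ω}
      ⊆ {ω | 0 ≤ totalOverlap ρ η φ φ.support ω - (1 - δ) * signal ρ η d φ.support} := by
    intro ω hω
    simp only [Set.mem_ofPred_eq] at hω ⊢
    linarith
  refine (measure_mono hsub).trans ((measure_nonneg_le_lintegral_eexp _ hm).trans ?_)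
  have hsplit : ∀ ω : Samp n d,
      totalOverlap ρ η φ φ.support ω - (1 - δ) * signal ρ η d φ.support
      = (-(1 - δ) * signal ρ η d φ.support
          + overlap ρ (edgePerm φ) (touching φ.support) (graphPart ω))
        + overlap η (featPerm d φ) (φ.support ×ˢ Finset.univ) (featPart ω) := by
    intro ω; rw [totalOverlap]; ring
  simp_rw [hsplit]
  have hprod := lintegral_eexp_parts (n := n) (d := d)
    (f := fun q => -(1 - δ) * signal ρ η d φ.support
      + overlap ρ (edgePerm φ) (touching φ.support) q)
    (g := fun q => overlap η (featPerm d φ) (φ.support ×ˢ Finset.univ) q)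
    (by fun_prop) (by fun_prop)
  rw [hprod]
  simp_rw [eexp_add]
  rw [lintegral_const_mul _ (by fun_prop)]
  refine (mul_le_mul' (mul_le_mul_right (lintegral_eexp_overlap_le hρ _
    (support_edgePerm_subset φ) (by linarith)) _) (lintegral_eexp_overlap_le hη (featPerm d φ)
      (support_featPerm φ).subset (by linarith))).trans ?_
  rw [← eexp_add, ← eexp_add, ← eexp_add]
  refine eexp_mono ?_
  have hone : ∀ {x m : ℝ}, 0 ≤ x → x ≤ κ → 0 ≤ m →
      x / 2 * m + 50 * x ^ 2 * m ≤ (1 / 2 + 50 * κ) * (x * m) := by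
    intro x m hx0 hx hm
    nlinarith [mul_nonneg (mul_nonneg hx0 (sub_nonneg.2 hx)) hm]
  have h1 := hone (m := #(touching φ.support)) (snr_nonneg hρ) hρκ (by positivity)
  have h2 := hone (m := #φ.support * d) (snr_nonneg hη) hηκ (by positivity)
  have h3 : (#(φ.support ×ˢ (Finset.univ : Finset (Fin d))) : ℝ) = #φ.support * d := by
    rw [Finset.card_product]; simp
  have h4 : (φ.support ×ˢ (Finset.univ : Finset (Fin d))) \ (featPerm d φ).support = ∅ := by
    rw [support_featPerm, Finset.sdiff_self]
  have h5 : snr ρ * (#(touching φ.support \ (edgePerm φ).support) : ℝ) ≤ snr ρ * #φ.support :=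
    mul_le_mul_of_nonneg_left (Nat.cast_le.2 (card_touching_sdiff_le φ)) (snr_nonneg hρ)
  rw [h3, h4, Finset.card_empty, Nat.cast_zero, mul_zero]
  unfold signal
  linarith

end Tail

section UnionBound

variable {n d : ℕ} {ρ η ε L : ℝ}

lemma measure_V_neg_le_exp_card (hρ : ρ ^ 2 ≤ 1) (hη : η ^ 2 ≤ 1) (hε0 : 0 < ε) (hε1 : ε ≤ 1)
    (hL : 0 ≤ L) (hn : 1280 ≤ ε ^ 2 * n) (φ : Equiv.Perm (Fin n))
    (hS : 4 * (1 + ε) * L ≤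
      min (snr ρ) (ε ^ 2 / 40000) * n + min (snr η) (ε ^ 2 / 40000) * d)
    (hφ : #φ.support ≤ ε / 8 * n ∨
      20 * L ≤ min (snr ρ) (ε ^ 2 / 40000) * n + min (snr η) (ε ^ 2 / 40000) * d) :
    μ n d {ω | V ρ η φ ω < 0} ≤ eexp (-((1 + ε / 4) * L * #φ.support)) := by
  have hκε : ε ^ 2 ≤ ε := by nlinarith
  refine (measure_V_neg_le hρ hη (κ := ε ^ 2 / 40000) (by positivity) (by linarith) φ).trans
    (eexp_mono (neg_le_neg ?_))
  set a := min (snr ρ) (ε ^ 2 / 40000) with ha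
  set b := min (snr η) (ε ^ 2 / 40000) with hb
  have ha0 : 0 ≤ a := le_min (snr_nonneg hρ) (by positivity)
  have hb0 : 0 ≤ b := le_min (snr_nonneg hη) (by positivity)
  have hm := card_support_edgePerm_ge φ
  have htn : (#φ.support : ℝ) ≤ n := by
    exact_mod_cast (Finset.card_le_univ φ.support).trans_eq (Fintype.card_fin n)
  set m := (#(edgePerm φ).support : ℝ)
  set t := (#φ.support : ℝ)
  have ht0 : 0 ≤ t := by positivity
  have hn0 : (0 : ℝ) ≤ n := by positivity
  have hεn : 1280 ≤ ε * n := hn.trans (mul_le_mul_of_nonneg_right hκε hn0)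
  have hn1 : (1280 : ℝ) ≤ n := hεn.trans (mul_le_of_le_one_left hn0 hε1)
  -- a common lower bound once `m ≥ θ t n`
  have key : ∀ θ : ℝ, 0 ≤ θ → θ ≤ 1 → θ * (t * n) ≤ m →
      (1 - ε / 8) / 4 * (θ * (t * (a * n + b * d)))
        ≤ (1 - 12 * (ε ^ 2 / 40000)) / 4 * (a * m + b * (t * d)) := by
    intro θ hθ0 hθ1 hθm
    have h1 : a * (θ * (t * n)) ≤ a * m := mul_le_mul_of_nonneg_left hθm ha0
    have h2 : θ * (b * (t * d)) ≤ b * (t * d) := mul_le_of_le_one_left (by positivity) hθ1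
    have h3 : θ * (t * (a * n + b * d)) ≤ a * m + b * (t * d) := by linarith
    exact mul_le_mul (by linarith) h3 (by positivity) (by linarith)
  have htL : 0 ≤ t * L := by positivity
  rcases hφ with hsmall | hlarge
  · refine le_trans ?_ (key (1 - ε / 8) (by linarith) (by linarith) ?_)
    · have h1 : t * (4 * (1 + ε) * L) ≤ t * (a * n + b * d) := mul_le_mul_of_nonneg_left hS ht0
      have h2 : 1 + ε / 4 ≤ (1 - ε / 8) * (1 - ε / 8) * (1 + ε) := by nlinarith
      have h3 : (1 - ε / 8) * ((1 - ε / 8) * (t * (4 * (1 + ε) * L)))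
          ≤ (1 - ε / 8) * ((1 - ε / 8) * (t * (a * n + b * d))) :=
        mul_le_mul_of_nonneg_left (mul_le_mul_of_nonneg_left h1 (by linarith)) (by linarith)
      have h4 := mul_le_mul_of_nonneg_right h2 htL
      linarith
    · refine le_trans ?_ hm
      have : (1 - ε / 8) * n ≤ n - (t + 3) / 2 := by linarith
      nlinarith [mul_le_mul_of_nonneg_left this ht0]
  · refine le_trans ?_ (key (2 / 5) (by norm_num) (by norm_num) ?_)
    · have h1 : t * (20 * L) ≤ t * (a * n + b * d) := mul_le_mul_of_nonneg_left hlarge ht0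
      have h2 : (7 / 8) * (t * (a * n + b * d)) ≤ (1 - ε / 8) * (t * (a * n + b * d)) :=
        mul_le_mul_of_nonneg_right (by linarith) (by positivity)
      have h3 : ε * (t * L) ≤ t * L := mul_le_of_le_one_left htL hε1
      linarith
    · refine le_trans ?_ hm
      have : 2 / 5 * n ≤ n - (t + 3) / 2 := by linarith
      nlinarith [mul_le_mul_of_nonneg_left this ht0]

lemma signal_ge (hρ : ρ ^ 2 ≤ 1) (hη : η ^ 2 ≤ 1) (hε0 : 0 < ε) (hε1 : ε ≤ 1)
    (hL : 0 ≤ L) (hn : 1280 ≤ ε ^ 2 * n) (hS : 4 * (1 + ε) * L ≤ snr ρ * n + snr η * d)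
    (K : Finset (Fin n)) : 2 * (1 + 3 / 4 * ε) * L * #K ≤ signal ρ η d K := by
  have ha0 := snr_nonneg hρ
  have hb0 := snr_nonneg hη
  have htn : (#K : ℝ) ≤ n := by
    exact_mod_cast (Finset.card_le_univ K).trans_eq (Fintype.card_fin n)
  unfold signal
  rw [card_touching]
  set t := (#K : ℝ)
  have ht0 : 0 ≤ t := by positivity
  have hn0 : (0 : ℝ) ≤ n := by positivity
  have hεn : 1280 ≤ ε * n := hn.trans (mul_le_mul_of_nonneg_right (by nlinarith) hn0)
  have h1 : (1 - ε / 8) / 2 * n ≤ n - (t + 1) / 2 := by linarith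
  have h2 : snr ρ * (t * ((1 - ε / 8) / 2 * n)) ≤ snr ρ * (t * (n - (t + 1) / 2)) :=
    mul_le_mul_of_nonneg_left (mul_le_mul_of_nonneg_left h1 ht0) ha0
  have h3 : (1 - ε / 8) / 2 * (snr η * (t * d)) ≤ snr η * (t * d) :=
    mul_le_of_le_one_left (by positivity) (by linarith)
  have h4 : (1 - ε / 8) / 2 * (t * (4 * (1 + ε) * L))
      ≤ (1 - ε / 8) / 2 * (t * (snr ρ * n + snr η * d)) :=
    mul_le_mul_of_nonneg_left (mul_le_mul_of_nonneg_left hS ht0) (by linarith)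
  have h5 : 1 + 3 / 4 * ε ≤ (1 - ε / 8) * (1 + ε) := by nlinarith
  have h6 := mul_le_mul_of_nonneg_right h5 (mul_nonneg ht0 hL)
  linarith

lemma measure_totalOverlap_ge_le_exp_card (hρ : ρ ^ 2 ≤ 1) (hη : η ^ 2 ≤ 1) (hε0 : 0 < ε)
    (hε1 : ε ≤ 1) (hL : 0 ≤ L) (hn : 1280 ≤ ε ^ 2 * n)
    (hρκ : snr ρ ≤ ε ^ 2 / 40000) (hηκ : snr η ≤ ε ^ 2 / 40000)
    (hS : 4 * (1 + ε) * L ≤ snr ρ * n + snr η * d) (hS' : snr ρ * n + snr η * d ≤ 20 * L)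
    (φ : Equiv.Perm (Fin n)) (hφ : ε / 8 * n ≤ #φ.support) :
    μ n d {ω | (1 - ε / 32) * signal ρ η d φ.support ≤ totalOverlap ρ η φ φ.support ω}
      ≤ eexp (-((1 + ε / 4) * L * #φ.support)) := by
  have hκε : ε ^ 2 ≤ ε := by nlinarith
  refine (measure_totalOverlap_ge hρ hη (by linarith) hρκ hηκ φ).trans (eexp_mono ?_)
  have hsig := signal_ge hρ hη hε0 hε1 hL hn hS φ.support
  have htn : (#φ.support : ℝ) ≤ n := by
    exact_mod_cast (Finset.card_le_univ φ.support).trans_eq (Fintype.card_fin n)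
  set t := (#φ.support : ℝ)
  have ht0 : 0 ≤ t := by positivity
  have hb0 := snr_nonneg hη
  have h1 : snr ρ * t ≤ 20 * L := by
    have := mul_le_mul_of_nonneg_left htn (snr_nonneg hρ)
    have : 0 ≤ snr η * d := by positivity
    linarith
  have h2 : 160 ≤ ε * t := by
    have := mul_le_mul_of_nonneg_left hφ hε0.le
    linarith
  have h3 : 160 * L ≤ ε * t * L := mul_le_mul_of_nonneg_right h2 hL
  have h4 : (1 / 2 - ε / 16) * (2 * (1 + 3 / 4 * ε) * L * t)
      ≤ (1 / 2 - ε / 32 - 50 * (ε ^ 2 / 40000)) * signal ρ η d φ.support :=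
    mul_le_mul (by linarith) hsig (by positivity) (by linarith)
  have h5 : 1 + 3 / 8 * ε ≤ (1 / 2 - ε / 16) * (2 * (1 + 3 / 4 * ε)) := by nlinarith
  have h6 := mul_le_mul_of_nonneg_right h5 (mul_nonneg hL ht0)
  linarith

lemma measure_totalOverlap_one_le_exp (hρ : ρ ^ 2 ≤ 1) (hη : η ^ 2 ≤ 1) (hε0 : 0 < ε)
    (hε1 : ε ≤ 1) (hL : 0 ≤ L) (hn : 1280 ≤ ε ^ 2 * n)
    (hρκ : snr ρ ≤ ε ^ 2 / 40000) (hηκ : snr η ≤ ε ^ 2 / 40000)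
    (hS : 4 * (1 + ε) * L ≤ snr ρ * n + snr η * d)
    (K : Finset (Fin n)) (hK : ε / 8 * n ≤ #K) :
    μ n d {ω | totalOverlap ρ η 1 K ω ≤ (1 - ε / 32) * signal ρ η d K}
      ≤ eexp (-(ε ^ 3 / 16384 * (n * L))) := by
  have hκε : ε ^ 2 ≤ ε := by nlinarith
  refine (measure_totalOverlap_one_le hρ hη (by linarith) hρκ hηκ (by linarith) (by linarith)
    K).trans (eexp_mono (neg_le_neg ?_))
  have hsig := signal_ge hρ hη hε0 hε1 hL hn hS K
  have h1 : ε / 8 * n * L ≤ #K * L := mul_le_mul_of_nonneg_right hK hL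
  have h2 : 2 * (#K * L) ≤ signal ρ η d K := by
    have : 0 ≤ ε * (L * #K) := by positivity
    linarith
  have h3 : ε ^ 2 / 4096 * (ε / 4 * n * L)
      ≤ ((ε / 32) ^ 2 / 2 - 8 * (ε ^ 2 / 40000)) * signal ρ η d K :=
    mul_le_mul (by nlinarith [sq_nonneg ε]) (by linarith) (by positivity)
      (by nlinarith [sq_nonneg ε])
  calc ε ^ 3 / 16384 * (n * L) = ε ^ 2 / 4096 * (ε / 4 * n * L) := by ring
    _ ≤ _ := h3

lemma measure_exists_V_neg_le (hρ : ρ ^ 2 ≤ 1) (hη : η ^ 2 ≤ 1) (hε0 : 0 < ε) (hε1 : ε ≤ 1)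
    (hL : 0 ≤ L) (hn : 1280 ≤ ε ^ 2 * n) (hnL : 20 * L ≤ ε ^ 2 / 40000 * n)
    (hdL : 20 * L ≤ ε ^ 2 / 40000 * d) (hS : 4 * (1 + ε) * L ≤ snr ρ * n + snr η * d) :
    μ n d {ω | ∃ φ : Equiv.Perm (Fin n), 2 ≤ #φ.support ∧ V ρ η φ ω < 0}
      ≤ ∑ φ : Equiv.Perm (Fin n) with 2 ≤ #φ.support, eexp (-((1 + ε / 4) * L * #φ.support))
        + 2 ^ n * eexp (-(ε ^ 3 / 16384 * (n * L))) := by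
  have ha0 := snr_nonneg hρ
  have hb0 := snr_nonneg hη
  set κ := ε ^ 2 / 40000 with hκ
  have hκ0 : 0 ≤ κ := by positivity
  have hcase : 20 * L ≤ min (snr ρ) κ * n + min (snr η) κ * d ∨
      (snr ρ ≤ κ ∧ snr η ≤ κ ∧ snr ρ * n + snr η * d ≤ 20 * L) := by
    have hn0 : 0 ≤ min (snr ρ) κ * n := mul_nonneg (le_min ha0 hκ0) (by positivity)
    have hd0 : 0 ≤ min (snr η) κ * d := mul_nonneg (le_min hb0 hκ0) (by positivity)
    rcases le_total κ (snr ρ) with h | h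
    · rw [min_eq_right h]; left; linarith
    rcases le_total κ (snr η) with h' | h'
    · rw [min_eq_right h']; left; linarith
    rw [min_eq_left h, min_eq_left h']
    exact (le_total _ _).imp_right fun h'' => ⟨h, h', h''⟩
  have hεL : ε * L ≤ L := mul_le_of_le_one_left hL hε1
  rcases hcase with hlarge | ⟨hρκ, hηκ, hS'⟩
  · have hsub : {ω : Samp n d | ∃ φ : Equiv.Perm (Fin n), 2 ≤ #φ.support ∧ V ρ η φ ω < 0}
        ⊆ ⋃ φ ∈ (Finset.univ.filter fun φ : Equiv.Perm (Fin n) => 2 ≤ #φ.support),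
          {ω | V ρ η φ ω < 0} := by
      rintro ω ⟨φ, h2, hV⟩
      exact Set.mem_biUnion (Finset.mem_coe.2 (Finset.mem_filter.2 ⟨Finset.mem_univ _, h2⟩)) hV
    refine (measure_mono hsub).trans ((measure_biUnion_finset_le _ _).trans
      (le_add_right (Finset.sum_le_sum fun φ _ => ?_)))
    exact measure_V_neg_le_exp_card hρ hη hε0 hε1 hL hn φ (by linarith) (Or.inr hlarge)
  · let A : Equiv.Perm (Fin n) → Set (Samp n d) := fun φ =>
      if #φ.support ≤ ε / 8 * n then {ω | V ρ η φ ω < 0}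
      else {ω | (1 - ε / 32) * signal ρ η d φ.support ≤ totalOverlap ρ η φ φ.support ω}
    let B : Finset (Fin n) → Set (Samp n d) := fun K =>
      {ω | ε / 8 * n ≤ #K ∧ totalOverlap ρ η 1 K ω ≤ (1 - ε / 32) * signal ρ η d K}
    have hsub : {ω : Samp n d | ∃ φ : Equiv.Perm (Fin n), 2 ≤ #φ.support ∧ V ρ η φ ω < 0}
        ⊆ (⋃ φ ∈ (Finset.univ.filter fun φ : Equiv.Perm (Fin n) => 2 ≤ #φ.support), A φ)
          ∪ ⋃ K ∈ (Finset.univ : Finset (Finset (Fin n))), B K := by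
      rintro ω ⟨φ, h2, hV⟩
      have hmem : φ ∈ (Finset.univ.filter fun φ : Equiv.Perm (Fin n) => 2 ≤ #φ.support) :=
        Finset.mem_filter.2 ⟨Finset.mem_univ _, h2⟩
      by_cases ht : (#φ.support : ℝ) ≤ ε / 8 * n
      · refine Or.inl (Set.mem_biUnion (Finset.mem_coe.2 hmem) ?_)
        simp only [A, if_pos ht]
        exact hV
      by_cases hov : (1 - ε / 32) * signal ρ η d φ.support ≤ totalOverlap ρ η φ φ.support ω
      · refine Or.inl (Set.mem_biUnion (Finset.mem_coe.2 hmem) ?_)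
        simp only [A, if_neg ht]
        exact hov
      · refine Or.inr (Set.mem_biUnion (Finset.mem_coe.2 (Finset.mem_univ φ.support)) ?_)
        rw [V_eq_totalOverlap_sub] at hV
        exact ⟨(not_le.1 ht).le, by linarith [not_le.1 hov]⟩
    refine (measure_mono hsub).trans ((measure_union_le _ _).trans (add_le_add
      ((measure_biUnion_finset_le _ _).trans (Finset.sum_le_sum fun φ _ => ?_))
      ((measure_biUnion_finset_le _ _).trans ?_)))
    · by_cases ht : (#φ.support : ℝ) ≤ ε / 8 * n
      · simp only [A, if_pos ht]
        refine measure_V_neg_le_exp_card hρ hη hε0 hε1 hL hn φ ?_ (Or.inl ht)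
        rw [min_eq_left hρκ, min_eq_left hηκ]
        exact hS
      · simp only [A, if_neg ht]
        exact measure_totalOverlap_ge_le_exp_card hρ hη hε0 hε1 hL hn hρκ hηκ hS hS' φ
          (not_le.1 ht).le
    · have hB : ∀ K ∈ (Finset.univ : Finset (Finset (Fin n))),
          μ n d (B K) ≤ eexp (-(ε ^ 3 / 16384 * (n * L))) := by
        intro K _
        by_cases hK : ε / 8 * n ≤ #K
        · exact (measure_mono fun ω hω => hω.2).trans
            (measure_totalOverlap_one_le_exp hρ hη hε0 hε1 hL hn hρκ hηκ hS K hK)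
        · have : B K = ∅ := Set.eq_empty_of_forall_notMem fun ω hω => hK hω.1
          simp [this]
      refine (Finset.sum_le_sum hB).trans_eq ?_
      simp

lemma sum_eexp_neg_card_support_le {c : ℝ} (hn : n ≠ 0)
    (hc : Real.exp (-(c * Real.log n)) ≤ 1 / 2) :
    ∑ φ : Equiv.Perm (Fin n) with 2 ≤ #φ.support,
      eexp (-((1 + c) * Real.log n * #φ.support))
      ≤ ENNReal.ofReal (2 * Real.exp (-(c * Real.log n)) ^ 2) := by
  have hpow : ∀ φ : Equiv.Perm (Fin n), Real.exp (-((1 + c) * Real.log n * #φ.support))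
      = (Real.exp (-(c * Real.log n)) / n) ^ #φ.support := by
    intro φ
    have hn' : (0 : ℝ) < n := by positivity
    nth_rw 3 [← Real.exp_log hn']
    rw [← Real.exp_sub, ← Real.exp_nat_mul]
    congr 1
    ring
  simp_rw [eexp, hpow]
  rw [← ENNReal.ofReal_sum_of_nonneg fun φ _ => by positivity]
  exact ENNReal.ofReal_le_ofReal (sum_perm_pow_card_support_le (by positivity) hc)

lemma two_pow_mul_eexp_le {c : ℝ} (hL : Real.log 2 + 1 ≤ c * L) :
    2 ^ n * eexp (-(c * (n * L))) ≤ ENNReal.ofReal (Real.exp (-n)) := by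
  have h2 : (2 : ENNReal) ^ n = eexp (n * Real.log 2) := by
    rw [eexp, Real.exp_nat_mul, Real.exp_log two_pos, ENNReal.ofReal_pow two_pos.le]
    simp
  rw [h2, ← eexp_add]
  refine eexp_mono ?_
  nlinarith [mul_le_mul_of_nonneg_left hL n.cast_nonneg]

end UnionBound

end CGM

open CGM in
/-- **MAP success on all orbits (Lemma 4.1).**  Assume `d = ω(log n)` and, for some
`ε > 0` and all sufficiently large `n`, `ρ²n/(1−ρ²) + η²d/(1−η²) ≥ 4(1+ε) log n`.  With
`E_t := {∃ φ ∈ S_{n,t} : V(φ) < 0}`, one has `P(⋃_{2 ≤ t ≤ n} E_t) = o(1)`; equivalently,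
the probability that some permutation `φ` with `|D_φ| ≥ 2` (i.e. some `φ ≠ id`) satisfies
`V(φ) < 0` tends to `0`. -/
theorem MAP_succeeds_on_all_orbits (d : ℕ → ℕ) (ρ η : ℕ → ℝ)
    (hρ : ∀ n, ρ n ∈ Set.Icc (-1 : ℝ) 1) (hη : ∀ n, η n ∈ Set.Icc (-1 : ℝ) 1)
    (hd : Tendsto (fun n : ℕ => (d n : ℝ) / Real.log n) atTop atTop)
    (hsig : ∃ ε > (0 : ℝ), ∀ᶠ n : ℕ in atTop,
      4 * (1 + ε) * Real.log n ≤
        (ρ n) ^ 2 * n / (1 - (ρ n) ^ 2) + (η n) ^ 2 * (d n) / (1 - (η n) ^ 2)) :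
    Tendsto
      (fun n => μ n (d n)
        {ω | ∃ φ : Equiv.Perm (Fin n), 2 ≤ φ.support.card ∧ V (ρ n) (η n) φ ω < 0})
      atTop (𝓝 0) := by
  obtain ⟨ε₀, hε₀, hsig⟩ := hsig
  have hlog : Tendsto (fun n : ℕ => Real.log n) atTop atTop :=
    Real.tendsto_log_atTop.comp tendsto_natCast_atTop_atTop
  obtain ⟨ε, hε0, hε1, hεε₀⟩ : ∃ ε : ℝ, 0 < ε ∧ ε ≤ 1 ∧ ε ≤ ε₀ :=
    ⟨min ε₀ 1, lt_min hε₀ one_pos, min_le_right _ _, min_le_left _ _⟩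
  have hz : Tendsto (fun n : ℕ => Real.exp (-(ε / 4 * Real.log n))) atTop (𝓝 0) :=
    Real.tendsto_exp_neg_atTop_nhds_zero.comp (hlog.const_mul_atTop (by positivity))
  have hexp : Tendsto (fun n : ℕ => Real.exp (-(n : ℝ))) atTop (𝓝 0) :=
    Real.tendsto_exp_neg_atTop_nhds_zero.comp tendsto_natCast_atTop_atTop
  have hbound : Tendsto (fun n : ℕ =>
      ENNReal.ofReal (2 * Real.exp (-(ε / 4 * Real.log n)) ^ 2)
        + ENNReal.ofReal (Real.exp (-(n : ℝ)))) atTop (𝓝 0) := by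
    have h1 := ENNReal.tendsto_ofReal ((hz.pow 2).const_mul 2)
    have h2 := ENNReal.tendsto_ofReal hexp
    simpa using h1.add h2
  refine tendsto_of_tendsto_of_tendsto_of_le_of_le' tendsto_const_nhds hbound
    (Eventually.of_forall fun _ => zero_le) ?_
  have hsq : ∀ {x : ℝ}, x ∈ Set.Icc (-1 : ℝ) 1 → x ^ 2 ≤ 1 := fun hx =>
    (sq_le_one_iff_abs_le_one _).2 (abs_le.2 hx)
  have hε2 : 0 < ε ^ 2 := by positivity
  have hlin : ∀ᶠ n : ℕ in atTop, Real.log n ≤ ε ^ 2 / 800000 * n := by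
    have h := (Real.isLittleO_log_id_atTop.comp_tendsto
      (tendsto_natCast_atTop_atTop (R := ℝ))).bound (c := ε ^ 2 / 800000) (by positivity)
    filter_upwards [h] with n hn
    simpa using (le_abs_self _).trans hn
  filter_upwards [hsig, hlin, hd.eventually_ge_atTop (800000 / ε ^ 2),
    hz.eventually_le_const (show (0 : ℝ) < 1 / 2 by norm_num),
    hlog.eventually_ge_atTop ((Real.log 2 + 1) / (ε ^ 3 / 16384)),
    (tendsto_natCast_atTop_atTop (R := ℝ)).eventually_ge_atTop (1280 / ε ^ 2),
    hlog.eventually_gt_atTop 0, eventually_ne_atTop 0]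
    with n hsign hlinn hdn hzn hLn hnn hL0 hn0
  rw [div_le_iff₀ (by positivity)] at hLn hnn
  rw [div_le_div_iff₀ hε2 hL0] at hdn
  refine (measure_exists_V_neg_le (hsq (hρ n)) (hsq (hη n)) hε0 hε1 hL0.le (by linarith)
    (by linarith) (by linarith) ?_).trans (add_le_add (sum_eexp_neg_card_support_le hn0 hzn)
      (two_pow_mul_eexp_le (by linarith)))
  refine le_trans ?_ (hsign.trans_eq (by unfold snr; ring))
  exact mul_le_mul_of_nonneg_right (by linarith) hL0.le
end
end

section
/- (Concentration of log Z.) In the Gaussian contextual graph matching model with π* = id, assume d = ω((log n)²) and ρ²n/(1−ρ²) + 2η²d/(1−η²) ≤ 2(1−ε) log n for some ε > 0. Then for any sequence a_n = Ω(n (log n)^{3/4}), |log Z − E[log Z]| ≤ a_n with probability at least 1 − exp(−Ω(n √(log n))). -/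
open MeasureTheory ProbabilityTheory Real Filter Finset Topology

noncomputable section

section GaussianConcentration

variable {E : Type*} [NormedAddCommGroup E] [InnerProductSpace ℝ E]

lemma sub_eq_integral_fderiv_rotation {f : E → ℝ} (hf : ContDiff ℝ 1 f) (p : E × E) :
    f p.2 - f p.1 = ∫ θ in (0)..(π / 2),
      fderiv ℝ f (ContinuousLinearMap.rotation θ p).1 (ContinuousLinearMap.rotation θ p).2 := by
  have hfd : Continuous (fderiv ℝ f) := hf.continuous_fderiv one_ne_zero
  have hd : ∀ θ : ℝ, HasDerivAt (fun θ => f (ContinuousLinearMap.rotation θ p).1)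
      (fderiv ℝ f (ContinuousLinearMap.rotation θ p).1 (ContinuousLinearMap.rotation θ p).2) θ := by
    intro θ
    have h1 : HasDerivAt (fun θ : ℝ => cos θ • p.1 + sin θ • p.2)
        (-sin θ • p.1 + cos θ • p.2) θ :=
      ((hasDerivAt_cos θ).smul_const p.1).add ((hasDerivAt_sin θ).smul_const p.2)
    exact ((hf.differentiable one_ne_zero) _).hasFDerivAt.comp_hasDerivAt θ h1
  have hcont : Continuous fun θ : ℝ => fderiv ℝ f (ContinuousLinearMap.rotation θ p).1
      (ContinuousLinearMap.rotation θ p).2 := by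
    simp only [ContinuousLinearMap.rotation_apply]
    exact (hfd.comp (by fun_prop)).clm_apply (by fun_prop)
  rw [intervalIntegral.integral_eq_sub_of_hasDerivAt (fun θ _ => hd θ)
    (hcont.intervalIntegrable _ _)]
  simp [ContinuousLinearMap.rotation_apply]

variable [FiniteDimensional ℝ E] [MeasurableSpace E] [BorelSpace E]

lemma lintegral_exp_dual_stdGaussian (L : StrongDual ℝ E) (t : ℝ) :
    ∫⁻ y, ENNReal.ofReal (exp (t * L y)) ∂stdGaussian E
      = ENNReal.ofReal (exp (t ^ 2 / 2 * ‖L‖ ^ 2)) := by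
  have hmap : (stdGaussian E).map L = gaussianReal 0 (‖L‖ ^ 2).toNNReal := by
    rw [IsGaussian.map_eq_gaussianReal, integral_strongDual_stdGaussian, variance_dual_stdGaussian]
  have hmgf := mgf_gaussianReal hmap t
  have hint : Integrable (fun y => exp (t * L y)) (stdGaussian E) :=
    (mgf_pos_iff (X := L)).1 (by rw [hmgf]; positivity)
  rw [← ofReal_integral_eq_lintegral_ofReal hint (ae_of_all _ fun _ => (exp_pos _).le)]
  congr 1
  refine Eq.trans hmgf ?_
  rw [Real.coe_toNNReal _ (by positivity)]
  congr 1
  ring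

/-- Jensen's inequality for the exponential of an integral over `[0, π / 2]`. -/
lemma ofReal_exp_integral_le {h : ℝ → ℝ} (hh : Continuous h) (c : ℝ) :
    ENNReal.ofReal (exp (c * ∫ θ in (0)..(π / 2), h θ)) ≤
      ENNReal.ofReal (2 / π) *
        ∫⁻ θ in Set.Ioc 0 (π / 2), ENNReal.ofReal (exp (c * (π / 2) * h θ)) := by
  have hpi : (0 : ℝ) < π / 2 := by positivity
  have hvol : volume.real (Set.Ioc 0 (π / 2)) = π / 2 := by
    simp [measureReal_def, hpi.le]
  have hc : Continuous fun θ => c * (π / 2) * h θ := by fun_prop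
  have hi : IntegrableOn (fun θ => exp (c * (π / 2) * h θ)) (Set.Ioc 0 (π / 2)) :=
    (hc.rexp.integrableOn_Icc).mono_set Set.Ioc_subset_Icc_self
  have key := convexOn_exp.map_set_average_le (μ := volume) (t := Set.Ioc 0 (π / 2))
    (f := fun θ => c * (π / 2) * h θ) continuous_exp.continuousOn isClosed_univ
    (by simp [hpi]) (by simp) (by simp)
    ((hc.integrableOn_Icc).mono_set Set.Ioc_subset_Icc_self) hi
  rw [setAverage_eq, setAverage_eq, hvol, integral_const_mul] at key
  rw [← ofReal_integral_eq_lintegral_ofReal hi (ae_of_all _ fun _ => (exp_pos _).le),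
    ← ENNReal.ofReal_mul (by positivity), intervalIntegral.integral_of_le hpi.le]
  apply ENNReal.ofReal_le_ofReal
  have e : (π / 2)⁻¹ • (c * (π / 2) * ∫ θ in Set.Ioc 0 (π / 2), h θ)
      = c * ∫ θ in Set.Ioc 0 (π / 2), h θ := by
    rw [smul_eq_mul]; field_simp
  rw [e, smul_eq_mul] at key
  rwa [show (2 / π) = (π / 2)⁻¹ by rw [inv_div]]

lemma lintegral_lintegral_rotation_stdGaussian {Φ : E × E → ENNReal} (hΦ : Measurable Φ) :
    ∫⁻ p, (∫⁻ θ in Set.Ioc 0 (π / 2), Φ (ContinuousLinearMap.rotation θ p))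
        ∂((stdGaussian E).prod (stdGaussian E)) =
      ENNReal.ofReal (π / 2) * ∫⁻ p, Φ p ∂((stdGaussian E).prod (stdGaussian E)) := by
  have hrot : Continuous fun q : (E × E) × ℝ => ContinuousLinearMap.rotation q.2 q.1 := by
    simp only [ContinuousLinearMap.rotation_apply]
    fun_prop
  have hm : Measurable fun q : (E × E) × ℝ => Φ (ContinuousLinearMap.rotation q.2 q.1) :=
    hΦ.comp hrot.measurable
  rw [lintegral_lintegral_swap (f := fun p θ => Φ (ContinuousLinearMap.rotation θ p))
    hm.aemeasurable]
  have hinner : ∀ θ : ℝ, ∫⁻ p, Φ (ContinuousLinearMap.rotation θ p)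
      ∂((stdGaussian E).prod (stdGaussian E)) =
      ∫⁻ p, Φ p ∂((stdGaussian E).prod (stdGaussian E)) := by
    intro θ
    rw [← lintegral_map hΦ (ContinuousLinearMap.continuous _).measurable,
      IsGaussian.map_rotation_eq_self (by simp)]
  simp_rw [hinner]
  rw [lintegral_const, Measure.restrict_apply_univ, Real.volume_Ioc, sub_zero, mul_comm]

/-- The **Maurey–Pisier inequality** for exponential moments. -/
theorem lintegral_exp_sub_prod_stdGaussian_le {f : E → ℝ} (hf : ContDiff ℝ 1 f) (c : ℝ) :
    ∫⁻ p, ENNReal.ofReal (exp (c * (f p.2 - f p.1))) ∂((stdGaussian E).prod (stdGaussian E)) ≤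
      ∫⁻ x, ENNReal.ofReal (exp (c ^ 2 * (π ^ 2 / 8) * ‖fderiv ℝ f x‖ ^ 2)) ∂stdGaussian E := by
  have hfd : Continuous (fderiv ℝ f) := hf.continuous_fderiv one_ne_zero
  have hΦm : Measurable fun p : E × E =>
      ENNReal.ofReal (exp (c * (π / 2) * fderiv ℝ f p.1 p.2)) := by
    have : Continuous fun p : E × E => fderiv ℝ f p.1 p.2 :=
      (hfd.comp continuous_fst).clm_apply continuous_snd
    exact ENNReal.measurable_ofReal.comp (by fun_prop)
  calc
    _ ≤ ∫⁻ p, (ENNReal.ofReal (2 / π) * ∫⁻ θ in Set.Ioc 0 (π / 2),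
          ENNReal.ofReal (exp (c * (π / 2) * fderiv ℝ f (ContinuousLinearMap.rotation θ p).1
            (ContinuousLinearMap.rotation θ p).2))) ∂((stdGaussian E).prod (stdGaussian E)) := by
        refine lintegral_mono fun p => ?_
        rw [sub_eq_integral_fderiv_rotation hf p]
        refine ofReal_exp_integral_le ?_ c
        simp only [ContinuousLinearMap.rotation_apply]
        exact (hfd.comp (by fun_prop)).clm_apply (by fun_prop)
    _ = ∫⁻ p, ENNReal.ofReal (exp (c * (π / 2) * fderiv ℝ f p.1 p.2))
          ∂((stdGaussian E).prod (stdGaussian E)) := by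
        rw [lintegral_const_mul' _ _ ENNReal.ofReal_ne_top,
          lintegral_lintegral_rotation_stdGaussian hΦm, ← mul_assoc,
          ← ENNReal.ofReal_mul (by positivity), div_mul_div_cancel₀ pi_ne_zero]
        simp
    _ = _ := by
        rw [lintegral_prod _ hΦm.aemeasurable]
        refine lintegral_congr fun x => ?_
        refine (lintegral_exp_dual_stdGaussian (fderiv ℝ f x) _).trans ?_
        congr 2
        ring

/-- Exponential integrability of the increments of `f` for both signs implies integrability. -/
lemma integrable_of_lintegral_exp_sub {α : Type*} [MeasurableSpace α] {ν : Measure α}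
    [IsProbabilityMeasure ν] {f : α → ℝ} (hf : Measurable f)
    (hfin : ∫⁻ p, ENNReal.ofReal (exp (f p.2 - f p.1)) ∂(ν.prod ν) ≠ ⊤) :
    Integrable f ν := by
  have hm : Measurable fun p : α × α => ENNReal.ofReal (exp (f p.2 - f p.1)) := by fun_prop
  have h1 : ∫⁻ p, ENNReal.ofReal (exp (f p.1 - f p.2)) ∂(ν.prod ν) ≠ ⊤ := by
    rw [← lintegral_prod_swap] at hfin
    exact hfin
  have hint : Integrable (fun p : α × α => f p.2 - f p.1) (ν.prod ν) := by
    refine ⟨by fun_prop, ?_⟩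
    refine lt_of_le_of_lt (b := ∫⁻ p, (ENNReal.ofReal (exp (f p.2 - f p.1)) +
      ENNReal.ofReal (exp (f p.1 - f p.2))) ∂(ν.prod ν)) ?_ ?_
    · refine lintegral_mono fun p => ?_
      rw [← ofReal_norm, ← ENNReal.ofReal_add (exp_pos _).le (exp_pos _).le]
      apply ENNReal.ofReal_le_ofReal
      rw [Real.norm_eq_abs]
      have a1 := add_one_le_exp (f p.2 - f p.1)
      have a2 := add_one_le_exp (f p.1 - f p.2)
      have a3 := exp_pos (f p.2 - f p.1)
      have a4 := exp_pos (f p.1 - f p.2)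
      rw [abs_le]
      constructor <;> linarith
    · rw [lintegral_add_left hm]
      exact ENNReal.add_lt_top.2 ⟨hfin.lt_top, h1.lt_top⟩
  obtain ⟨x, hx⟩ := hint.prod_right_ae.exists
  have := hx.add (integrable_const (f x))
  refine this.congr (ae_of_all _ fun y => ?_)
  simp

lemma measure_gt_le_of_lintegral_exp_sub {α : Type*} [MeasurableSpace α] {ν : Measure α}
    [IsProbabilityMeasure ν] {f : α → ℝ} (hf : Measurable f) (hi : Integrable f ν) (a : ℝ) :
    ν {x | a < f x - ∫ y, f y ∂ν} ≤
      ENNReal.ofReal (exp (-a)) * ∫⁻ p, ENNReal.ofReal (exp (f p.2 - f p.1)) ∂(ν.prod ν) := by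
  set m := ∫ y, f y ∂ν with hm
  have hprod : ∫⁻ p, ENNReal.ofReal (exp (f p.2 - f p.1)) ∂(ν.prod ν) =
      (∫⁻ x, ENNReal.ofReal (exp (m - f x)) ∂ν) * ∫⁻ y, ENNReal.ofReal (exp (f y - m)) ∂ν := by
    rw [← lintegral_prod_mul (by fun_prop) (by fun_prop)]
    refine lintegral_congr fun p => ?_
    rw [← ENNReal.ofReal_mul (exp_pos _).le, ← exp_add]
    congr 2
    ring
  have hone : 1 ≤ ∫⁻ x, ENNReal.ofReal (exp (m - f x)) ∂ν := by
    have hi' : Integrable (fun x => 1 + (m - f x)) ν :=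
      (integrable_const 1).add ((integrable_const m).sub hi)
    calc (1 : ENNReal) = ENNReal.ofReal (∫ x, (1 + (m - f x)) ∂ν) := by
          have e : ∫ x, (1 + (m - f x)) ∂ν = 1 := by
            rw [integral_add (f := fun _ => (1 : ℝ)) (g := fun x => m - f x) (integrable_const _)
              ((integrable_const m).sub hi), integral_sub (integrable_const _) hi]
            simp [← hm]
          rw [e, ENNReal.ofReal_one]
      _ ≤ ∫⁻ x, ENNReal.ofReal (1 + (m - f x)) ∂ν := by
          rw [integral_eq_lintegral_pos_part_sub_lintegral_neg_part hi']
          refine (ENNReal.ofReal_le_ofReal (sub_le_self _ ENNReal.toReal_nonneg)).trans ?_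
          exact ENNReal.ofReal_toReal_le
      _ ≤ _ := by
          refine lintegral_mono fun x => ENNReal.ofReal_le_ofReal ?_
          linarith [add_one_le_exp (m - f x)]
  have hmarkov := mul_meas_ge_le_lintegral₀ (μ := ν)
    (f := fun y => ENNReal.ofReal (exp (f y - m))) (by fun_prop) (ENNReal.ofReal (exp a))
  calc ν {x | a < f x - m}
      ≤ ν {x | ENNReal.ofReal (exp a) ≤ ENNReal.ofReal (exp (f x - m))} := by
        refine measure_mono fun x hx => ?_
        exact ENNReal.ofReal_le_ofReal (exp_le_exp.2 (le_of_lt hx))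
    _ = ENNReal.ofReal (exp (-a)) * (ENNReal.ofReal (exp a) *
          ν {x | ENNReal.ofReal (exp a) ≤ ENNReal.ofReal (exp (f x - m))}) := by
        rw [← mul_assoc, ← ENNReal.ofReal_mul (exp_pos _).le, ← exp_add]
        simp
    _ ≤ ENNReal.ofReal (exp (-a)) * ∫⁻ y, ENNReal.ofReal (exp (f y - m)) ∂ν := by gcongr
    _ ≤ _ := by
        rw [hprod]
        gcongr
        exact le_mul_of_one_le_left' hone

/-- Two-sided deviation bound for a `C¹` function of a standard Gaussian vector, under an
exponential moment bound on its squared gradient. -/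
theorem stdGaussian_abs_sub_integral_gt_le {f : E → ℝ} (hf : ContDiff ℝ 1 f) {c K : ℝ} (hc : 0 < c)
    (hK : ∫⁻ x, ENNReal.ofReal (exp (c ^ 2 * (π ^ 2 / 8) * ‖fderiv ℝ f x‖ ^ 2)) ∂stdGaussian E
      ≤ ENNReal.ofReal (exp K)) (a : ℝ) :
    stdGaussian E {x | a < |f x - ∫ y, f y ∂stdGaussian E|} ≤
      ENNReal.ofReal (2 * exp (K - c * a)) := by
  have hfm : Measurable f := hf.continuous.measurable
  have main : ∀ s : ℝ, s ^ 2 = c ^ 2 →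
      stdGaussian E {x | c * a < s * f x - ∫ y, s * f y ∂stdGaussian E} ≤
        ENNReal.ofReal (exp (K - c * a)) ∧ Integrable (fun x => s * f x) (stdGaussian E) := by
    intro s hs
    have hb : ∫⁻ p, ENNReal.ofReal (exp (s * f p.2 - s * f p.1))
        ∂((stdGaussian E).prod (stdGaussian E)) ≤ ENNReal.ofReal (exp K) := by
      simp_rw [← mul_sub]
      refine (lintegral_exp_sub_prod_stdGaussian_le hf s).trans ?_
      rwa [hs]
    have hi := integrable_of_lintegral_exp_sub (f := fun x => s * f x) (by fun_prop)
      (hb.trans_lt ENNReal.ofReal_lt_top).ne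
    refine ⟨(measure_gt_le_of_lintegral_exp_sub (by fun_prop) hi _).trans ?_, hi⟩
    rw [show K - c * a = -(c * a) + K by ring, exp_add, ENNReal.ofReal_mul (exp_pos _).le]
    gcongr
  have h1 := (main c rfl).1
  have h2 := (main (-c) (by ring)).1
  rw [integral_const_mul] at h1 h2
  calc _ ≤ stdGaussian E ({x | c * a < c * f x - c * ∫ y, f y ∂stdGaussian E} ∪
        {x | c * a < -c * f x - -c * ∫ y, f y ∂stdGaussian E}) := by
        refine measure_mono fun x hx => ?_
        rcases lt_abs.1 (show a < |_| from hx) with h | h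
        · left
          change c * a < _
          nlinarith
        · right
          change c * a < _
          nlinarith
    _ ≤ _ := measure_union_le _ _
    _ ≤ _ := add_le_add h1 h2
    _ = _ := by rw [← ENNReal.ofReal_add (exp_pos _).le (exp_pos _).le, two_mul]

end GaussianConcentration

section GaussianSquares

lemma exp_mul_sq_gaussianReal {t : ℝ} (ht : t ≤ 1 / 4) :
    Integrable (fun x => exp (t * x ^ 2)) (gaussianReal 0 1) ∧
      ∫ x, exp (t * x ^ 2) ∂gaussianReal 0 1 = (√(1 - 2 * t))⁻¹ := by
  have hb : 0 < 1 / 2 - t := by linarith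
  have e : ∀ x : ℝ, gaussianPDFReal 0 1 x * exp (t * x ^ 2) =
      (√(2 * π))⁻¹ * exp (-(1 / 2 - t) * x ^ 2) := by
    intro x
    rw [gaussianPDFReal_def]
    simp only [NNReal.coe_one, mul_one, sub_zero]
    rw [mul_assoc, ← exp_add]
    congr 2
    ring
  constructor
  · rw [gaussianReal_of_var_ne_zero 0 one_ne_zero,
      integrable_withDensity_iff (measurable_gaussianPDF 0 1) (ae_of_all _ fun _ => gaussianPDF_lt_top)]
    simp_rw [toReal_gaussianPDF, mul_comm (exp _), e]
    exact (integrable_exp_neg_mul_sq hb).const_mul _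
  · rw [integral_gaussianReal_eq_integral_smul one_ne_zero]
    simp_rw [smul_eq_mul, e]
    rw [integral_const_mul, integral_gaussian, ← sqrt_inv, ← sqrt_inv, ← sqrt_mul (by positivity)]
    congr 1
    have : 1 - 2 * t ≠ 0 := by linarith
    have : (1 / 2 - t) ≠ 0 := hb.ne'
    field_simp

lemma inv_sqrt_one_sub_le {t : ℝ} (h0 : 0 ≤ t) (ht : t ≤ 1 / 4) :
    (√(1 - 2 * t))⁻¹ ≤ exp (2 * t) := by
  rw [inv_le_comm₀ (sqrt_pos.2 (by linarith)) (exp_pos _), ← exp_neg]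
  apply le_sqrt_of_sq_le
  rw [← exp_nat_mul]
  have h1 := add_one_le_exp (4 * t)
  have h2 : exp ((2 : ℕ) * -(2 * t)) = (exp (4 * t))⁻¹ := by
    rw [← exp_neg]; congr 1; push_cast; ring
  rw [h2, inv_le_comm₀ (exp_pos _) (by linarith)]
  refine le_trans ?_ h1
  rw [inv_le_iff_one_le_mul₀ (by linarith)]
  nlinarith

/-- Exponential moment of a diagonal quadratic form in a standard Gaussian vector. -/
theorem lintegral_exp_sum_mul_sq_stdGaussian_le {ι : Type*} [Fintype ι] {w : ι → ℝ}
    (h0 : ∀ i, 0 ≤ w i) (hw : ∀ i, w i ≤ 1 / 4) :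
    ∫⁻ x, ENNReal.ofReal (exp (∑ i, w i * x i ^ 2)) ∂stdGaussian (EuclideanSpace ℝ ι) ≤
      ENNReal.ofReal (exp (2 * ∑ i, w i)) := by
  rw [← map_pi_eq_stdGaussian, lintegral_map (by fun_prop) (by fun_prop)]
  simp only [exp_sum]
  rw [← ofReal_integral_eq_lintegral_ofReal
    (Integrable.fintype_prod (f := fun i x => exp (w i * x ^ 2))
      fun i => (exp_mul_sq_gaussianReal (hw i)).1)
    (ae_of_all _ fun _ => prod_nonneg fun _ _ => (exp_pos _).le)]
  apply ENNReal.ofReal_le_ofReal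
  rw [integral_fintype_prod_eq_prod (f := fun i x => exp (w i * x ^ 2)), mul_sum, exp_sum]
  refine prod_le_prod (fun i _ => integral_nonneg fun _ => (exp_pos _).le) fun i _ => ?_
  rw [(exp_mul_sq_gaussianReal (hw i)).2]
  exact inv_sqrt_one_sub_le (h0 i) (hw i)

end GaussianSquares

namespace CGM

/-- Index set of the independent standard Gaussian coordinates of a sample. -/
abbrev CoordIdx (n d : ℕ) :=
  ((Fin n × Fin n) ⊕ (Fin n × Fin n)) ⊕ ((Fin n × Fin d) ⊕ (Fin n × Fin d))

/-- The sample whose coordinates are listed in a vector. -/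
def toSamp {n d : ℕ} (x : EuclideanSpace ℝ (CoordIdx n d)) : Samp n d :=
  ((fun i j => x (.inl (.inl (i, j))), fun i j => x (.inl (.inr (i, j)))),
    (fun i j => x (.inr (.inl (i, j))), fun i j => x (.inr (.inr (i, j)))))

lemma measurePreserving_curry_gaussian (m k : ℕ) :
    MeasurePreserving (MeasurableEquiv.curry (Fin m) (Fin k) ℝ)
      (Measure.pi fun _ => gaussianReal 0 1)
      (Measure.pi fun _ => Measure.pi fun _ => gaussianReal 0 1) := by
  refine ⟨MeasurableEquiv.measurable _, ?_⟩
  have := Measure.infinitePi_map_curry (fun (_ : Fin m) (_ : Fin k) => gaussianReal 0 1)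
  simpa only [Measure.infinitePi_eq_pi] using this

lemma measurePreserving_toSamp (n d : ℕ) :
    MeasurePreserving (toSamp (n := n) (d := d))
      (stdGaussian (EuclideanSpace ℝ (CoordIdx n d))) (μ n d) := by
  have h0 : MeasurePreserving (WithLp.ofLp (p := 2) (V := CoordIdx n d → ℝ))
      (stdGaussian (EuclideanSpace ℝ (CoordIdx n d)))
      (Measure.pi fun _ => gaussianReal 0 1) := by
    refine ⟨by fun_prop, ?_⟩
    rw [← map_pi_eq_stdGaussian, Measure.map_map (by fun_prop) (by fun_prop)]
    exact Measure.map_id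
  have h1 := measurePreserving_sumPiEquivProdPi (fun _ : CoordIdx n d => gaussianReal 0 1)
  have hG := measurePreserving_sumPiEquivProdPi
    (fun _ : (Fin n × Fin n) ⊕ (Fin n × Fin n) => gaussianReal 0 1)
  have hF := measurePreserving_sumPiEquivProdPi
    (fun _ : (Fin n × Fin d) ⊕ (Fin n × Fin d) => gaussianReal 0 1)
  have cG := measurePreserving_curry_gaussian n n
  have cF := measurePreserving_curry_gaussian n d
  exact ((((cG.prod cG).comp hG).prod ((cF.prod cF).comp hF)).comp h1).comp h0

variable {n d : ℕ}

/-- squared Euclidean length of the graph part of a sample -/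
def sqG (ω : Samp n d) : ℝ := ∑ i, ∑ j, (ω.1.1 i j ^ 2 + ω.1.2 i j ^ 2)

/-- squared Euclidean length of the feature part of a sample -/
def sqF (ω : Samp n d) : ℝ := ∑ i, ∑ j, (ω.2.1 i j ^ 2 + ω.2.2 i j ^ 2)

lemma sqG_nonneg (ω : Samp n d) : 0 ≤ sqG ω :=
  sum_nonneg fun _ _ => sum_nonneg fun _ _ => by positivity

lemma sqF_nonneg (ω : Samp n d) : 0 ≤ sqF ω :=
  sum_nonneg fun _ _ => sum_nonneg fun _ _ => by positivity

/-- The weight vector of a diagonal quadratic form giving weight `a` to graph coordinates and `b`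
to feature coordinates. -/
def blockWeight (a b : ℝ) : CoordIdx n d → ℝ := Sum.elim (fun _ => a) (fun _ => b)

lemma sum_blockWeight_mul_sq (a b : ℝ) (x : EuclideanSpace ℝ (CoordIdx n d)) :
    ∑ i, blockWeight a b i * x i ^ 2 = a * sqG (toSamp x) + b * sqF (toSamp x) := by
  simp only [blockWeight, Fintype.sum_sum_type, Sum.elim_inl, Sum.elim_inr, sqG, sqF, toSamp,
    Fintype.sum_prod_type, ← mul_sum, sum_add_distrib]

lemma norm_sq_eq_sqG_add_sqF (x : EuclideanSpace ℝ (CoordIdx n d)) :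
    ‖x‖ ^ 2 = sqG (toSamp x) + sqF (toSamp x) := by
  have := sum_blockWeight_mul_sq 1 1 x
  rw [one_mul, one_mul] at this
  rw [EuclideanSpace.real_norm_sq_eq, ← this]
  exact sum_congr rfl fun i _ => by rcases i with i | i <;> simp [blockWeight]

lemma sum_blockWeight (a b : ℝ) :
    ∑ i, blockWeight (n := n) (d := d) a b i = 2 * (a * n ^ 2 + b * (n * d)) := by
  simp only [blockWeight, Fintype.sum_sum_type, Sum.elim_inl, Sum.elim_inr, sum_const, card_univ,
    Fintype.card_sum, Fintype.card_prod, Fintype.card_fin, nsmul_eq_mul]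
  push_cast
  ring

lemma abs_sum_mul_le_of_sq_le {ι κ : Type*} [Fintype κ] {s : Finset ι}
    {e₁ e₂ : ι → κ} (h₁ : Set.InjOn e₁ s) (h₂ : Set.InjOn e₂ s) {g h : κ → ℝ} {P Q : ℝ}
    (hg : ∑ k, g k ^ 2 ≤ P ^ 2) (hh : ∑ k, h k ^ 2 ≤ Q ^ 2) (hP : 0 ≤ P) (hQ : 0 ≤ Q) :
    |∑ i ∈ s, g (e₁ i) * h (e₂ i)| ≤ P * Q := by
  classical
  have aux : ∀ {e : ι → κ}, Set.InjOn e s → ∀ u : κ → ℝ, ∑ i ∈ s, u (e i) ^ 2 ≤ ∑ k, u k ^ 2 := by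
    intro e he u
    rw [← sum_image (f := fun k => u k ^ 2) he]
    exact sum_le_sum_of_subset_of_nonneg (subset_univ _) fun _ _ _ => sq_nonneg _
  apply abs_le_of_sq_le_sq _ (by positivity)
  rw [mul_pow]
  refine (sum_mul_sq_le_sq_mul_sq s _ _).trans ?_
  exact mul_le_mul ((aux h₁ g).trans hg) ((aux h₂ h).trans hh)
    (sum_nonneg fun _ _ => sq_nonneg _) (sq_nonneg _)

lemma sum_sym_sq_le (f : GW n) :
    ∑ p : Fin n × Fin n, sym f p.1 p.2 ^ 2 ≤ 2 * ∑ i, ∑ j, f i j ^ 2 := by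
  have h : ∀ i j, sym f i j ^ 2 ≤ f i j ^ 2 + f j i ^ 2 := by
    intro i j
    unfold sym
    split_ifs <;> nlinarith [sq_nonneg (f i j), sq_nonneg (f j i)]
  rw [Fintype.sum_prod_type]
  calc _ ≤ ∑ i, ∑ j, (f i j ^ 2 + f j i ^ 2) := sum_le_sum fun i _ => sum_le_sum fun j _ => h i j
    _ = _ := by
      simp only [sum_add_distrib]
      rw [sum_comm (f := fun i j => f j i ^ 2), two_mul]

lemma sum_Amat_sq_le (ω : Samp n d) :
    ∑ p : Fin n × Fin n, Amat ω p.1 p.2 ^ 2 ≤ 2 * sqG ω := by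
  refine (sum_sym_sq_le _).trans ?_
  unfold sqG
  gcongr with i _ j _
  nlinarith [sq_nonneg (ω.1.2 i j)]

lemma sq_combination_le {r : ℝ} (hr : r ^ 2 ≤ 1) (a b : ℝ) :
    (r * a + √(1 - r ^ 2) * b) ^ 2 ≤ a ^ 2 + b ^ 2 := by
  have h := sq_sqrt (sub_nonneg.2 hr)
  nlinarith [sq_nonneg (√(1 - r ^ 2) * a - r * b)]

lemma sum_Bmat_sq_le {ρ : ℝ} (hρ : ρ ^ 2 ≤ 1) (ω : Samp n d) :
    ∑ p : Fin n × Fin n, Bmat ρ ω p.1 p.2 ^ 2 ≤ 2 * sqG ω := by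
  calc _ ≤ ∑ p : Fin n × Fin n, (sym ω.1.1 p.1 p.2 ^ 2 + sym ω.1.2 p.1 p.2 ^ 2) :=
        sum_le_sum fun p _ => sq_combination_le hρ _ _
    _ ≤ 2 * ∑ i, ∑ j, ω.1.1 i j ^ 2 + 2 * ∑ i, ∑ j, ω.1.2 i j ^ 2 := by
        rw [sum_add_distrib]
        exact add_le_add (sum_sym_sq_le _) (sum_sym_sq_le _)
    _ = _ := by simp only [sqG, sum_add_distrib]; ring

lemma sum_Xmat_sq_le (ω : Samp n d) :
    ∑ p : Fin n × Fin d, Xmat ω p.1 p.2 ^ 2 ≤ sqF ω := by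
  rw [Fintype.sum_prod_type]
  unfold sqF Xmat
  gcongr with i _ j _
  nlinarith [sq_nonneg (ω.2.2 i j)]

lemma sum_Ymat_sq_le {η : ℝ} (hη : η ^ 2 ≤ 1) (ω : Samp n d) :
    ∑ p : Fin n × Fin d, Ymat η ω p.1 p.2 ^ 2 ≤ sqF ω := by
  rw [Fintype.sum_prod_type]
  exact sum_le_sum fun i _ => sum_le_sum fun j _ => sq_combination_le hη _ _

/-- The polarization of the quadratic form `V`: the derivative of `V` at `ω` towards `ω'`. -/
def polarV (ρ η : ℝ) (φ : Equiv.Perm (Fin n)) (ω ω' : Samp n d) : ℝ :=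
  ρ / (1 - ρ ^ 2) *
      ((∑ p ∈ movedEdges φ, Bmat ρ ω p.1 p.2 * Amat ω' p.1 p.2
          + ∑ p ∈ movedEdges φ, Bmat ρ ω' p.1 p.2 * Amat ω p.1 p.2)
        - (∑ p ∈ movedEdges φ, Bmat ρ ω (φ p.1) (φ p.2) * Amat ω' p.1 p.2
          + ∑ p ∈ movedEdges φ, Bmat ρ ω' (φ p.1) (φ p.2) * Amat ω p.1 p.2))
    + η / (1 - η ^ 2) *
      ((∑ p ∈ φ.support ×ˢ univ, Ymat η ω p.1 p.2 * Xmat ω' p.1 p.2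
          + ∑ p ∈ φ.support ×ˢ univ, Ymat η ω' p.1 p.2 * Xmat ω p.1 p.2)
        - (∑ p ∈ φ.support ×ˢ univ, Ymat η ω (φ p.1) p.2 * Xmat ω' p.1 p.2
          + ∑ p ∈ φ.support ×ˢ univ, Ymat η ω' (φ p.1) p.2 * Xmat ω p.1 p.2))

lemma sum_add_mul_mul_add_mul {ι : Type*} (s : Finset ι) (a b a' b' : ι → ℝ) (t : ℝ) :
    ∑ i ∈ s, (b i + t * b' i) * (a i + t * a' i) = ∑ i ∈ s, b i * a i
      + t * (∑ i ∈ s, b i * a' i + ∑ i ∈ s, b' i * a i) + t ^ 2 * ∑ i ∈ s, b' i * a' i := by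
  simp only [mul_sum, ← sum_add_distrib]
  exact sum_congr rfl fun i _ => by ring

lemma Amat_add_smul (ω ω' : Samp n d) (t : ℝ) (i j : Fin n) :
    Amat (ω + t • ω') i j = Amat ω i j + t * Amat ω' i j := by
  simp only [Amat, sym]
  split_ifs <;> simp

lemma Bmat_add_smul (ρ : ℝ) (ω ω' : Samp n d) (t : ℝ) (i j : Fin n) :
    Bmat ρ (ω + t • ω') i j = Bmat ρ ω i j + t * Bmat ρ ω' i j := by
  have h : sym (ω + t • ω').1.2 i j = sym ω.1.2 i j + t * sym ω'.1.2 i j := by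
    simp only [sym]
    split_ifs <;> simp
  simp only [Bmat, Amat_add_smul, h]
  ring

lemma Xmat_add_smul (ω ω' : Samp n d) (t : ℝ) (i : Fin n) (j : Fin d) :
    Xmat (ω + t • ω') i j = Xmat ω i j + t * Xmat ω' i j := by
  simp [Xmat]

lemma Ymat_add_smul (η : ℝ) (ω ω' : Samp n d) (t : ℝ) (i : Fin n) (j : Fin d) :
    Ymat η (ω + t • ω') i j = Ymat η ω i j + t * Ymat η ω' i j := by
  simp [Ymat]
  ring

lemma V_add_smul (ρ η : ℝ) (φ : Equiv.Perm (Fin n)) (ω ω' : Samp n d) (t : ℝ) :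
    V ρ η φ (ω + t • ω') = V ρ η φ ω + t * polarV ρ η φ ω ω' + t ^ 2 * V ρ η φ ω' := by
  unfold V VGstar VG VFstar VF polarV
  simp only [Amat_add_smul, Bmat_add_smul, Xmat_add_smul, Ymat_add_smul, sum_add_mul_mul_add_mul,
    sum_product]
  simp only [sum_add_distrib, ← mul_sum]
  ring

lemma hasDerivAt_V_line (ρ η : ℝ) (φ : Equiv.Perm (Fin n)) (ω ω' : Samp n d) :
    HasDerivAt (fun t : ℝ => V ρ η φ (ω + t • ω')) (polarV ρ η φ ω ω') 0 := by
  simp only [V_add_smul]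
  have h := (((hasDerivAt_id' (0 : ℝ)).mul_const (polarV ρ η φ ω ω')).const_add
    (V ρ η φ ω)).fun_add (((hasDerivAt_id' (0 : ℝ)).fun_pow 2).mul_const (V ρ η φ ω'))
  simpa using h

lemma abs_polarV_le {ρ η : ℝ} (hρ : ρ ^ 2 ≤ 1) (hη : η ^ 2 ≤ 1) (φ : Equiv.Perm (Fin n))
    (ω ω' : Samp n d) :
    |polarV ρ η φ ω ω'| ≤ 8 * (|ρ / (1 - ρ ^ 2)| * (√(sqG ω) * √(sqG ω'))
      + |η / (1 - η ^ 2)| * (√(sqF ω) * √(sqF ω'))) := by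
  have hG : ∀ ω : Samp n d, 2 * sqG ω ≤ (√2 * √(sqG ω)) ^ 2 := fun ω => by
    rw [mul_pow, sq_sqrt (by norm_num), sq_sqrt (sqG_nonneg ω)]
  have hF : ∀ ω : Samp n d, sqF ω ≤ (√(sqF ω)) ^ 2 := fun ω => by rw [sq_sqrt (sqF_nonneg ω)]
  have i1 : Set.InjOn (fun p : Fin n × Fin n => p) (movedEdges φ) := fun _ _ _ _ h => h
  have i2 : Set.InjOn (fun p : Fin n × Fin n => (φ p.1, φ p.2)) (movedEdges φ) :=
    (Function.Injective.prodMap φ.injective φ.injective).injOn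
  have i3 : Set.InjOn (fun p : Fin n × Fin d => p) ↑(φ.support ×ˢ (univ : Finset (Fin d))) :=
    fun _ _ _ _ h => h
  have i4 : Set.InjOn (fun p : Fin n × Fin d => (φ p.1, p.2))
      ↑(φ.support ×ˢ (univ : Finset (Fin d))) :=
    (Function.Injective.prodMap φ.injective Function.injective_id).injOn
  have gG : ∀ (e : Fin n × Fin n → Fin n × Fin n), Set.InjOn e (movedEdges φ) →
      ∀ ω ω' : Samp n d, |∑ p ∈ movedEdges φ, Bmat ρ ω (e p).1 (e p).2 * Amat ω' p.1 p.2| ≤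
        2 * (√(sqG ω) * √(sqG ω')) := by
    intro e he ω ω'
    refine (abs_sum_mul_le_of_sq_le (g := fun p => Bmat ρ ω p.1 p.2)
      (h := fun p => Amat ω' p.1 p.2) he i1 ((sum_Bmat_sq_le hρ ω).trans (hG ω))
      ((sum_Amat_sq_le ω').trans (hG ω')) (by positivity) (by positivity)).trans_eq ?_
    have := mul_self_sqrt (show (0 : ℝ) ≤ 2 by norm_num)
    linear_combination (√(sqG ω) * √(sqG ω')) * this
  have gF : ∀ (e : Fin n × Fin d → Fin n × Fin d),
      Set.InjOn e ↑(φ.support ×ˢ (univ : Finset (Fin d))) →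
      ∀ ω ω' : Samp n d,
        |∑ p ∈ φ.support ×ˢ univ, Ymat η ω (e p).1 (e p).2 * Xmat ω' p.1 p.2| ≤
        √(sqF ω) * √(sqF ω') := by
    intro e he ω ω'
    exact abs_sum_mul_le_of_sq_le (g := fun p => Ymat η ω p.1 p.2)
      (h := fun p => Xmat ω' p.1 p.2) he i3 ((sum_Ymat_sq_le hη ω).trans (hF ω))
      ((sum_Xmat_sq_le ω').trans (hF ω')) (by positivity) (by positivity)
  have four : ∀ {a b c e M : ℝ}, |a| ≤ M → |b| ≤ M → |c| ≤ M → |e| ≤ M →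
      |(a + b) - (c + e)| ≤ 4 * M := by
    intro a b c e M ha hb hc he
    rw [abs_le] at *
    constructor <;> linarith
  have hsF : 0 ≤ √(sqF ω) * √(sqF ω') := by positivity
  unfold polarV
  refine (abs_add_le _ _).trans ?_
  rw [abs_mul, abs_mul, mul_add]
  have kG := four (gG _ i1 ω ω') ((gG _ i1 ω' ω).trans_eq (by ring)) (gG _ i2 ω ω')
    ((gG _ i2 ω' ω).trans_eq (by ring))
  have kF := four (gF _ i3 ω ω') ((gF _ i3 ω' ω).trans_eq (by ring)) (gF _ i4 ω ω')
    ((gF _ i4 ω' ω).trans_eq (by ring))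
  refine add_le_add ?_ ?_
  · refine (mul_le_mul_of_nonneg_left kG (abs_nonneg _)).trans_eq (by ring)
  · refine (mul_le_mul_of_nonneg_left kF (abs_nonneg _)).trans ?_
    nlinarith [mul_nonneg (abs_nonneg (η / (1 - η ^ 2))) hsF]

lemma Zpart_pos (ρ η : ℝ) (ω : Samp n d) : 0 < Zpart ρ η ω :=
  sum_pos (fun _ _ => exp_pos _) univ_nonempty

lemma contDiff_logZ (ρ η : ℝ) :
    ContDiff ℝ 1 fun x : EuclideanSpace ℝ (CoordIdx n d) => log (Zpart ρ η (toSamp x)) := by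
  have hs : ∀ g : EuclideanSpace ℝ (CoordIdx n d) → GW n, (∀ i j, ContDiff ℝ 1 fun x => g x i j) →
      ∀ i j, ContDiff ℝ 1 fun x => sym (g x) i j := by
    intro g hg i j
    unfold sym
    split_ifs
    · exact hg i j
    · exact hg j i
  have hA : ∀ i j, ContDiff ℝ 1 fun x : EuclideanSpace ℝ (CoordIdx n d) => Amat (toSamp x) i j :=
    hs _ fun i j => by unfold toSamp; fun_prop
  have hB : ∀ i j, ContDiff ℝ 1 fun x : EuclideanSpace ℝ (CoordIdx n d) => Bmat ρ (toSamp x) i j :=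
    fun i j => (contDiff_const.mul (hA i j)).add
      (contDiff_const.mul (hs _ (fun i j => by unfold toSamp; fun_prop) i j))
  have hX : ∀ i j, ContDiff ℝ 1 fun x : EuclideanSpace ℝ (CoordIdx n d) => Xmat (toSamp x) i j :=
    fun i j => by unfold Xmat toSamp; fun_prop
  have hY : ∀ i j, ContDiff ℝ 1 fun x : EuclideanSpace ℝ (CoordIdx n d) => Ymat η (toSamp x) i j :=
    fun i j => by unfold Ymat toSamp; fun_prop
  refine ContDiff.log ?_ fun x => (Zpart_pos _ _ _).ne'
  unfold Zpart V VGstar VG VFstar VF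
  fun_prop

lemma sq_add_mul_mul_le (b g p q r s : ℝ) :
    (b * (p * q) + g * (r * s)) ^ 2 ≤ (b ^ 2 * p ^ 2 + g ^ 2 * r ^ 2) * (q ^ 2 + s ^ 2) := by
  nlinarith [sq_nonneg (b * p * s - g * r * q)]

lemma sq_norm_fderiv_logZ_le {ρ η : ℝ} (hρ : ρ ^ 2 ≤ 1) (hη : η ^ 2 ≤ 1)
    (x : EuclideanSpace ℝ (CoordIdx n d)) :
    ‖fderiv ℝ (fun x => log (Zpart ρ η (toSamp x))) x‖ ^ 2 ≤
      64 * ((ρ / (1 - ρ ^ 2)) ^ 2 * sqG (toSamp x) + (η / (1 - η ^ 2)) ^ 2 * sqF (toSamp x)) := by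
  set W := (ρ / (1 - ρ ^ 2)) ^ 2 * sqG (toSamp x) + (η / (1 - η ^ 2)) ^ 2 * sqF (toSamp x) with hW
  have hW0 : 0 ≤ W := add_nonneg (mul_nonneg (sq_nonneg _) (sqG_nonneg _))
    (mul_nonneg (sq_nonneg _) (sqF_nonneg _))
  suffices h : ‖fderiv ℝ (fun x => log (Zpart ρ η (toSamp x))) x‖ ≤ 8 * √W by
    calc _ ≤ (8 * √W) ^ 2 := by gcongr
      _ = _ := by rw [mul_pow, sq_sqrt hW0]; norm_num
  refine ContinuousLinearMap.opNorm_le_bound _ (by positivity) fun y => ?_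
  have hpol : ∀ φ : Equiv.Perm (Fin n),
      |polarV ρ η φ (toSamp x) (toSamp y)| ≤ 8 * √W * ‖y‖ := by
    intro φ
    refine (abs_polarV_le hρ hη φ _ _).trans ?_
    rw [mul_assoc]
    gcongr
    rw [← sqrt_sq (norm_nonneg y), norm_sq_eq_sqG_add_sqF, ← sqrt_mul hW0]
    apply le_sqrt_of_sq_le
    have e1 := sq_sqrt (sqG_nonneg (toSamp x))
    have e2 := sq_sqrt (sqG_nonneg (toSamp y))
    have e3 := sq_sqrt (sqF_nonneg (toSamp x))
    have e4 := sq_sqrt (sqF_nonneg (toSamp y))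
    rw [hW, ← sq_abs (ρ / _), ← sq_abs (η / _)]
    have := sq_add_mul_mul_le |ρ / (1 - ρ ^ 2)| |η / (1 - η ^ 2)| √(sqG (toSamp x))
      √(sqG (toSamp y)) √(sqF (toSamp x)) √(sqF (toSamp y))
    rwa [e1, e2, e3, e4] at this
  have hZ : HasDerivAt (fun t : ℝ => log (Zpart ρ η (toSamp x + t • toSamp y)))
      ((∑ φ, exp (-V ρ η φ (toSamp x)) * -polarV ρ η φ (toSamp x) (toSamp y)) /
        Zpart ρ η (toSamp x)) 0 := by
    have h1 : HasDerivAt (fun t : ℝ => Zpart ρ η (toSamp x + t • toSamp y))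
        (∑ φ, exp (-V ρ η φ (toSamp x)) * -polarV ρ η φ (toSamp x) (toSamp y)) 0 := by
      unfold Zpart
      refine HasDerivAt.fun_sum fun φ _ => ?_
      have := (hasDerivAt_V_line ρ η φ (toSamp x) (toSamp y)).fun_neg.exp
      simpa using this
    have := h1.log (Zpart_pos _ _ _).ne'
    simpa using this
  have hline : fderiv ℝ (fun x => log (Zpart ρ η (toSamp x))) x y =
      (∑ φ, exp (-V ρ η φ (toSamp x)) * -polarV ρ η φ (toSamp x) (toSamp y)) /
        Zpart ρ η (toSamp x) := by
    rw [← ((contDiff_logZ ρ η).differentiable one_ne_zero x).lineDeriv_eq_fderiv]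
    exact HasLineDerivAt.lineDeriv hZ
  rw [hline, norm_div, Real.norm_of_nonneg (Zpart_pos _ _ _).le, div_le_iff₀ (Zpart_pos _ _ _)]
  refine (norm_sum_le _ _).trans ?_
  unfold Zpart
  rw [mul_sum]
  refine sum_le_sum fun φ _ => ?_
  rw [norm_mul, norm_neg, Real.norm_of_nonneg (exp_pos _).le, Real.norm_eq_abs, mul_comm]
  exact mul_le_mul_of_nonneg_right (hpol φ) (exp_pos _).le

lemma measurable_logZ (ρ η : ℝ) : Measurable fun ω : Samp n d => log (Zpart ρ η ω) := by
  have hA : ∀ i j, Measurable fun ω : Samp n d => Amat ω i j := fun i j => by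
    unfold Amat sym
    split_ifs <;> fun_prop
  have hB : ∀ i j, Measurable fun ω : Samp n d => Bmat ρ ω i j := fun i j => by
    unfold Bmat
    have : Measurable fun ω : Samp n d => sym ω.1.2 i j := by
      unfold sym
      split_ifs <;> fun_prop
    fun_prop
  unfold Zpart V VGstar VG VFstar VF Ymat Xmat
  fun_prop

lemma measure_abs_logZ_sub_integral_gt_le {ρ η : ℝ} (hρ : ρ ^ 2 ≤ 1) (hη : η ^ 2 ≤ 1) {l : ℝ}
    (hl : 0 < l) (hG : 80 * l ^ 2 * (ρ / (1 - ρ ^ 2)) ^ 2 ≤ 1 / 4)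
    (hF : 80 * l ^ 2 * (η / (1 - η ^ 2)) ^ 2 ≤ 1 / 4) (a : ℝ) :
    μ n d {ω | a < |log (Zpart ρ η ω) - ∫ ω', log (Zpart ρ η ω') ∂μ n d|} ≤
      ENNReal.ofReal (2 * exp (320 * l ^ 2 * ((ρ / (1 - ρ ^ 2)) ^ 2 * n ^ 2
        + (η / (1 - η ^ 2)) ^ 2 * (n * d)) - l * a)) := by
  set β := ρ / (1 - ρ ^ 2)
  set γ := η / (1 - η ^ 2)
  have hmp := measurePreserving_toSamp n d
  have hmeas := measurable_logZ (n := n) (d := d) ρ η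
  have hint : ∫ ω', log (Zpart ρ η ω') ∂μ n d =
      ∫ x, log (Zpart ρ η (toSamp x)) ∂stdGaussian (EuclideanSpace ℝ (CoordIdx n d)) := by
    rw [← hmp.map_eq, integral_map hmp.aemeasurable hmeas.aestronglyMeasurable]
  rw [hint, ← hmp.measure_preimage
    (measurableSet_lt measurable_const (hmeas.sub_const _).abs).nullMeasurableSet]
  refine stdGaussian_abs_sub_integral_gt_le (contDiff_logZ ρ η) hl ?_ a
  have hw : ∀ i, 0 ≤ blockWeight (n := n) (d := d) (80 * l ^ 2 * β ^ 2) (80 * l ^ 2 * γ ^ 2) i ∧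
      blockWeight (n := n) (d := d) (80 * l ^ 2 * β ^ 2) (80 * l ^ 2 * γ ^ 2) i ≤ 1 / 4 := by
    rintro (i | i)
    · exact ⟨by simp only [blockWeight, Sum.elim_inl]; positivity, hG⟩
    · exact ⟨by simp only [blockWeight, Sum.elim_inr]; positivity, hF⟩
  have hexp := lintegral_exp_sum_mul_sq_stdGaussian_le (fun i => (hw i).1) fun i => (hw i).2
  rw [sum_blockWeight] at hexp
  refine le_trans (lintegral_mono fun x => ENNReal.ofReal_le_ofReal (exp_le_exp.2 ?_))
    (hexp.trans_eq (by congr 2; ring))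
  rw [sum_blockWeight_mul_sq]
  have hπ : π ^ 2 ≤ 10 := by nlinarith [pi_lt_d2, pi_pos]
  have hW : 0 ≤ β ^ 2 * sqG (toSamp x) + γ ^ 2 * sqF (toSamp x) :=
    add_nonneg (mul_nonneg (sq_nonneg _) (sqG_nonneg _))
      (mul_nonneg (sq_nonneg _) (sqF_nonneg _))
  calc _ ≤ l ^ 2 * (10 / 8) * (64 * (β ^ 2 * sqG (toSamp x) + γ ^ 2 * sqF (toSamp x))) := by
        gcongr
        exact sq_norm_fderiv_logZ_le hρ hη x
    _ = _ := by ring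

lemma sq_div_one_sub_sq_le {r B : ℝ} (hr : r ^ 2 ≤ 1) (h : r ^ 2 / (1 - r ^ 2) ≤ B) :
    (r / (1 - r ^ 2)) ^ 2 ≤ B * (1 + B) := by
  have h0 : 0 ≤ r ^ 2 / (1 - r ^ 2) := div_nonneg (sq_nonneg r) (sub_nonneg.2 hr)
  rcases eq_or_ne (1 - r ^ 2) 0 with h1 | h1
  · rw [h1, div_zero, zero_pow two_ne_zero]
    rw [h1, div_zero] at h
    positivity
  · calc (r / (1 - r ^ 2)) ^ 2 = r ^ 2 / (1 - r ^ 2) * (1 + r ^ 2 / (1 - r ^ 2)) := by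
          field_simp
          ring
      _ ≤ _ := by gcongr; exact h0.trans h

/-- The bounds on the signal strengths in terms of `s`, the fourth root of the signal bound. -/
lemma signal_bounds {ρ η N D s : ℝ} (hρ : ρ ^ 2 ≤ 1) (hη : η ^ 2 ≤ 1) (hs : 1 ≤ s)
    (hN : s ^ 4 ≤ N) (hD : s ^ 8 ≤ D)
    (h : ρ ^ 2 * N / (1 - ρ ^ 2) + 2 * η ^ 2 * D / (1 - η ^ 2) ≤ 2 * s ^ 4) :
    (ρ / (1 - ρ ^ 2)) ^ 2 * N ≤ 6 * s ^ 4 ∧ (η / (1 - η ^ 2)) ^ 2 * D ≤ 2 * s ^ 4 := by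
  have h1 : (1 : ℝ) ≤ s ^ 4 := one_le_pow₀ hs
  have hN0 : 0 < N := by linarith
  have hDs : s ^ 4 ≤ D := (pow_le_pow_right₀ hs (by norm_num)).trans hD
  have hD0 : 0 < D := by linarith
  have e1 : ρ ^ 2 * N / (1 - ρ ^ 2) = ρ ^ 2 / (1 - ρ ^ 2) * N := by ring
  have e2 : 2 * η ^ 2 * D / (1 - η ^ 2) = 2 * (η ^ 2 / (1 - η ^ 2) * D) := by ring
  have n1 : 0 ≤ ρ ^ 2 / (1 - ρ ^ 2) * N :=
    mul_nonneg (div_nonneg (sq_nonneg _) (sub_nonneg.2 hρ)) hN0.le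
  have n2 : 0 ≤ η ^ 2 / (1 - η ^ 2) * D :=
    mul_nonneg (div_nonneg (sq_nonneg _) (sub_nonneg.2 hη)) hD0.le
  rw [e1, e2] at h
  have b1 := sq_div_one_sub_sq_le hρ ((le_div_iff₀ hN0).2 (by linarith :
    ρ ^ 2 / (1 - ρ ^ 2) * N ≤ 2 * s ^ 4))
  have b2 := sq_div_one_sub_sq_le hη ((le_div_iff₀ hD0).2 (by linarith :
    η ^ 2 / (1 - η ^ 2) * D ≤ s ^ 4))
  have c1 : s ^ 4 / N ≤ 1 := (div_le_one hN0).2 hN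
  have c2 : s ^ 4 / D ≤ 1 := (div_le_one hD0).2 hDs
  constructor
  · calc _ ≤ 2 * s ^ 4 / N * (1 + 2 * s ^ 4 / N) * N := by gcongr
      _ = 2 * s ^ 4 * (1 + 2 * (s ^ 4 / N)) := by field_simp
      _ ≤ 2 * s ^ 4 * (1 + 2 * 1) := by gcongr
      _ = _ := by ring
  · calc _ ≤ s ^ 4 / D * (1 + s ^ 4 / D) * D := by gcongr
      _ = s ^ 4 * (1 + s ^ 4 / D) := by field_simp
      _ ≤ s ^ 4 * (1 + 1) := by gcongr
      _ = _ := by ring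

lemma measure_abs_logZ_sub_integral_gt_le_exp {ρ η s δ c a : ℝ} (hρ : ρ ^ 2 ≤ 1)
    (hη : η ^ 2 ≤ 1) (hs : 1 ≤ s) (hn : s ^ 4 ≤ n) (hd : s ^ 8 ≤ d)
    (h : ρ ^ 2 * n / (1 - ρ ^ 2) + 2 * η ^ 2 * d / (1 - η ^ 2) ≤ 2 * s ^ 4)
    (hδ : 0 < δ) (hδ' : δ ≤ 1 / 50) (hδc : 5120 * δ ≤ c) (ha : c * n * s ^ 3 ≤ a) :
    μ n d {ω | a < |log (Zpart ρ η ω) - ∫ ω', log (Zpart ρ η ω') ∂μ n d|} ≤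
      ENNReal.ofReal (2 * exp (-(δ * c / 2 * (n * s ^ 2)))) := by
  have hs0 : 0 < s := by linarith
  obtain ⟨b1, b2⟩ := signal_bounds hρ hη hs hn hd h
  have h1 : (1 : ℝ) ≤ s ^ 4 := one_le_pow₀ hs
  have hn0 : (0 : ℝ) < n := by linarith
  have hd0 : (0 : ℝ) < d := (pow_pos hs0 8).trans_le hd
  have hl2 : (δ / s) ^ 2 ≤ (1 / 50) ^ 2 := by
    exact pow_le_pow_left₀ (by positivity) ((div_le_self hδ.le hs).trans hδ') 2
  have g1 : (ρ / (1 - ρ ^ 2)) ^ 2 ≤ 6 := by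
    refine ((le_div_iff₀ hn0).2 b1).trans ((div_le_iff₀ hn0).2 (by linarith))
  have g2 : (η / (1 - η ^ 2)) ^ 2 ≤ 2 := by
    refine ((le_div_iff₀ hd0).2 b2).trans ((div_le_iff₀ hd0).2 ?_)
    have := (pow_le_pow_right₀ hs (by norm_num : 4 ≤ 8)).trans hd
    linarith
  refine (measure_abs_logZ_sub_integral_gt_le hρ hη (div_pos hδ hs0) ?_ ?_ a).trans ?_
  · calc _ ≤ 80 * (1 / 50 : ℝ) ^ 2 * 6 := by gcongr
      _ ≤ _ := by norm_num
  · calc _ ≤ 80 * (1 / 50 : ℝ) ^ 2 * 2 := by gcongr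
      _ ≤ _ := by norm_num
  · gcongr
    calc _ = 320 * (δ / s) ^ 2 * (n * ((ρ / (1 - ρ ^ 2)) ^ 2 * n + (η / (1 - η ^ 2)) ^ 2 * d))
          - δ / s * a := by ring
      _ ≤ 320 * (δ / s) ^ 2 * (n * (6 * s ^ 4 + 2 * s ^ 4)) - δ / s * (c * n * s ^ 3) := by
        gcongr
      _ = (2560 * δ - c) * δ * (n * s ^ 2) := by field_simp; ring
      _ ≤ (-(c / 2)) * δ * (n * s ^ 2) := by
        gcongr
        linarith
      _ = _ := by ring

end CGM

open CGM in
/-- **Concentration of `log Z` (Lemma C.1).**  If `d = ω((log n)²)` and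
`ρ²n/(1−ρ²) + 2η²d/(1−η²) ≤ 2(1−ε) log n` for some `ε > 0`, then for any sequence
`a_n = Ω(n (log n)^{3/4})` one has `|log Z − E[log Z]| ≤ a_n` with probability at least
`1 − exp(−Ω(n √(log n)))`. -/
theorem logZ_concentration (d : ℕ → ℕ) (ρ η : ℕ → ℝ)
    (hρ : ∀ n, ρ n ∈ Set.Icc (-1 : ℝ) 1) (hη : ∀ n, η n ∈ Set.Icc (-1 : ℝ) 1)
    (hd : Tendsto (fun n : ℕ => (d n : ℝ) / (Real.log n) ^ 2) atTop atTop)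
    (ε : ℝ) (hε : 0 < ε)
    (hsig : ∀ᶠ n : ℕ in atTop,
      (ρ n) ^ 2 * n / (1 - (ρ n) ^ 2) + 2 * (η n) ^ 2 * (d n) / (1 - (η n) ^ 2) ≤
        2 * (1 - ε) * Real.log n) :
    ∀ a : ℕ → ℝ,
      (∃ c > (0 : ℝ), ∀ᶠ n : ℕ in atTop, c * n * (Real.log n) ^ ((3 : ℝ) / 4) ≤ a n) →
      ∃ c' > (0 : ℝ), ∀ᶠ n : ℕ in atTop,
        1 - ENNReal.ofReal (Real.exp (-(c' * n * Real.sqrt (Real.log n)))) ≤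
          μ n (d n) {ω |
            |Real.log (Zpart (ρ n) (η n) ω) -
              ∫ ω', Real.log (Zpart (ρ n) (η n) ω') ∂μ n (d n)| ≤ a n} := by
  rintro a ⟨c, hc, ha⟩
  set δ := min (1 / 50) (c / 5120)
  have hδ0 : 0 < δ := by positivity
  have hδc : 5120 * δ ≤ c := by linarith [min_le_right (1 / 50 : ℝ) (c / 5120)]
  refine ⟨δ * c / 4, by positivity, ?_⟩
  have hlog : Tendsto (fun n : ℕ => log n) atTop atTop :=
    tendsto_log_atTop.comp tendsto_natCast_atTop_atTop
  have hlim : Tendsto (fun n : ℕ => (n : ℝ)) atTop atTop := tendsto_natCast_atTop_atTop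
  filter_upwards [ha, hsig, hlog.eventually_ge_atTop 1, hd.eventually_ge_atTop 1,
    hlim.eventually_ge_atTop (4 / (δ * c))] with n han hsign hl1 hdn hn
  set s := log n ^ ((1 : ℝ) / 4) with hs
  have hl0 : 0 ≤ log n := by linarith
  have hpow : ∀ k : ℕ, s ^ k = log n ^ ((k : ℝ) / 4) := fun k => by
    rw [hs, ← rpow_mul_natCast hl0]
    congr 1
    ring
  have hs1 : 1 ≤ s := one_le_rpow hl1 (by norm_num)
  have hs2 : s ^ 2 = √(log n) := by rw [hpow, sqrt_eq_rpow]; norm_num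
  have hs3 : s ^ 3 = log n ^ ((3 : ℝ) / 4) := by rw [hpow]; norm_num
  have hs4 : s ^ 4 = log n := by rw [hpow]; norm_num
  have hs8 : s ^ 8 = log n ^ 2 := by rw [← hs4]; ring
  have hsq : ∀ {r : ℝ}, r ∈ Set.Icc (-1 : ℝ) 1 → r ^ 2 ≤ 1 := fun h => by nlinarith [h.1, h.2]
  have htail := measure_abs_logZ_sub_integral_gt_le_exp (a := a n) (hsq (hρ n))
    (hsq (hη n)) hs1 (hs4.trans_le (log_le_self n.cast_nonneg))
    (hs8.trans_le (by rwa [one_le_div (by positivity)] at hdn))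
    (hsign.trans (by rw [hs4]; nlinarith)) hδ0 (min_le_left _ _)
    hδc (by rwa [hs3])
  have hexp : 2 * exp (-(δ * c / 2 * (n * s ^ 2))) ≤ exp (-(δ * c / 4 * n * √(log n))) := by
    have hx : 1 ≤ δ * c / 4 * (n * s ^ 2) := by
      have h1 : (1 : ℝ) ≤ s ^ 2 := one_le_pow₀ hs1
      rw [div_le_iff₀ (by positivity)] at hn
      nlinarith
    rw [← hs2]
    calc _ ≤ exp (δ * c / 4 * (n * s ^ 2)) * exp (-(δ * c / 2 * (n * s ^ 2))) := by
          gcongr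
          linarith [add_one_le_exp (δ * c / 4 * (n * s ^ 2))]
      _ = _ := by rw [← exp_add]; congr 1; ring
  have hprob : IsProbabilityMeasure (μ n (d n)) := by
    have := (measurePreserving_toSamp n (d n)).map_eq
    exact this ▸
      Measure.isProbabilityMeasure_map (measurePreserving_toSamp n (d n)).aemeasurable
  rw [tsub_le_iff_right, ← measure_univ (μ := μ n (d n))]
  refine (measure_univ_le_add_compl _).trans (add_le_add le_rfl ?_)
  simp only [Set.compl_ofPred, not_le]
  exact htail.trans (ENNReal.ofReal_le_ofReal hexp)
end
end
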